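/- arXiv:2507.10987 — 5 statements merged into one kernel-verified Lean document; each statement's English description precedes it below -/
import Mathlib

section
/- Let f be a matrix polynomial of degree 2m+1 whose coefficients satisfy Condition C, and suppose Hermitian q×q matrices s_0, ..., s_{2m} are Markov parameters of f. Let 𝒮₁ be the (m+1)×(m+1) block Hankel matrix whose (i,k) block is A_{2(m−i−k)} when i+k ≤ m and 0_q otherwise (the symmetrizer of z·g(z)), and let 𝒮₂ be the m×m block Hankel matrix whose (i,k) block is A_{2(m−1−i−k)} when i+k ≤ m−1 and 0_q otherwise. Then for all x, y ∈ ℂ: x²·g^♯(x²)·h(y²) − y²·h^♯(x²)·g(y²) = (x²−y²) · R_e(x) · 𝒮₁^♯ · J̃_m · H_{1,m} · J̃_m · 𝒮₁ · C_e(y), and x·y·( g^♯(x²)·h(y²) − h^♯(x²)·g(y²) ) = −(x²−y²) · R_o(x) · 𝒮₂^♯ · J̃_{m-1} · H_{2,m-1} · J̃_{m-1} · 𝒮₂ · C_o(y), where 𝒮₁^♯, 𝒮₂^♯ denote the same block Hankel matrices with each block replaced by its conjugate transpose, R_e(x) is the block row (I_q, x² I_q, ..., x^{2m} I_q), C_e(y)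 the block column (I_q; y² I_q; ...; y^{2m} I_q), R_o(x) the block row (x I_q, ..., x^{2m-1} I_q), and C_o(y) the block column (y I_q; ...; y^{2m-1} I_q). -/
open Matrix MeasureTheory
open scoped ComplexOrder

noncomputable section

/-- The space of `q × q` complex matrices. -/
abbrev Mat (q : ℕ) := Matrix (Fin q) (Fin q) ℂ

/-- The h-part of an even-degree matrix polynomial
`f(z) = A 0 * z^(2m) + ... + A (2m)`:  `h(z) = A 0 * z^m + A 2 * z^(m-1) + ... + A (2m)`. -/
def hEven (q m : ℕ) (A : ℕ → Mat q) (z : ℂ) : Mat q :=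
  ∑ j ∈ Finset.range (m + 1), z ^ (m - j) • A (2 * j)

/-- The g-part of an even-degree matrix polynomial:
`g(z) = A 1 * z^(m-1) + A 3 * z^(m-2) + ... + A (2m-1)`. -/
def gEven (q m : ℕ) (A : ℕ → Mat q) (z : ℂ) : Mat q :=
  ∑ j ∈ Finset.range m, z ^ (m - 1 - j) • A (2 * j + 1)

/-- The h-part of an odd-degree matrix polynomial
`f(z) = A 0 * z^(2m+1) + ... + A (2m+1)`:  `h(z) = A 1 * z^m + ... + A (2m+1)`. -/
def hOdd (q m : ℕ) (A : ℕ → Mat q) (z : ℂ) : Mat q :=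
  ∑ j ∈ Finset.range (m + 1), z ^ (m - j) • A (2 * j + 1)

/-- The g-part of an odd-degree matrix polynomial: `g(z) = A 0 * z^m + ... + A (2m)`. -/
def gOdd (q m : ℕ) (A : ℕ → Mat q) (z : ℂ) : Mat q :=
  ∑ j ∈ Finset.range (m + 1), z ^ (m - j) • A (2 * j)

/-- The matrix polynomial `f(z) = A 0 * z^n + A 1 * z^(n-1) + ... + A n`. -/
def fPoly (q n : ℕ) (A : ℕ → Mat q) (z : ℂ) : Mat q :=
  ∑ j ∈ Finset.range (n + 1), z ^ (n - j) • A j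

/-- Continued fraction for the even case:  `wEven q m c d j z = w_{m-1-j}(z)`, where
`w_{m-1}(z) = z c_{m-1} + d_{m-1}⁻¹` and `w_k(z) = z c_k + (d_k + w_{k+1}(z)⁻¹)⁻¹`. -/
def wEven (q m : ℕ) (c d : ℕ → Mat q) : ℕ → ℂ → Mat q
  | 0, z => z • c (m - 1) + (d (m - 1))⁻¹
  | j + 1, z => z • c (m - 2 - j) + (d (m - 2 - j) + (wEven q m c d j z)⁻¹)⁻¹

/-- Continued fraction for the odd case:  `wOdd q m c d j z = w_{m-1-j}(z)`, where
`w_{m-1}(z) = z c_{m-1} + (d_{m-1} + z⁻¹ c_m⁻¹)⁻¹`. -/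
def wOdd (q m : ℕ) (c d : ℕ → Mat q) : ℕ → ℂ → Mat q
  | 0, z => z • c (m - 1) + (d (m - 1) + z⁻¹ • (c m)⁻¹)⁻¹
  | j + 1, z => z • c (m - 2 - j) + (d (m - 2 - j) + (wOdd q m c d j z)⁻¹)⁻¹

/-- A Hurwitz-type matrix polynomial of degree 2m, described through its h-part and g-part:
there are Hermitian positive definite matrices `c_0, ..., c_{m-1}`, `d_0, ..., d_{m-1}` with
`g(z) h(z)⁻¹ = w_0(z)⁻¹` whenever `det (h z) ≠ 0` and all inverses in the recursion exist. -/
def IsHTMEven (q m : ℕ) (h g : ℂ → Mat q) : Prop :=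
  ∃ c d : ℕ → Mat q,
    (∀ k < m, (c k).PosDef) ∧ (∀ k < m, (d k).PosDef) ∧
    ∀ z : ℂ, (h z).det ≠ 0 →
      (∀ j < m, IsUnit (wEven q m c d j z).det) →
      (∀ j, j + 1 < m → IsUnit (d (m - 2 - j) + (wEven q m c d j z)⁻¹).det) →
      g z * (h z)⁻¹ = (wEven q m c d (m - 1) z)⁻¹

/-- A Hurwitz-type matrix polynomial of degree 2m+1, described through its h-part and g-part:
there are Hermitian positive definite matrices `c_0, ..., c_m`, `d_0, ..., d_{m-1}` with
`h(z) (z g(z))⁻¹ = w_0(z)⁻¹` whenever `z ≠ 0`, `det (g z) ≠ 0` and all inverses exist. -/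
def IsHTMOdd (q m : ℕ) (h g : ℂ → Mat q) : Prop :=
  ∃ c d : ℕ → Mat q,
    (∀ k ≤ m, (c k).PosDef) ∧ (∀ k < m, (d k).PosDef) ∧
    ∀ z : ℂ, z ≠ 0 → (g z).det ≠ 0 →
      IsUnit (d (m - 1) + z⁻¹ • (c m)⁻¹).det →
      (∀ j < m, IsUnit (wOdd q m c d j z).det) →
      (∀ j, j + 1 < m → IsUnit (d (m - 2 - j) + (wOdd q m c d j z)⁻¹).det) →
      h z * (z • g z)⁻¹ = (wOdd q m c d (m - 1) z)⁻¹

/-- `s_0, ..., s_{2m-1}` are Markov parameters of the even-degree polynomial with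
coefficients `A`:  `z^(2m) g(z) - (∑_{j<2m} (-1)^j s_j z^(2m-1-j)) h(z)` has degree ≤ m-1. -/
def MarkovEven (q m : ℕ) (A s : ℕ → Mat q) : Prop :=
  ∃ B : ℕ → Mat q, ∀ z : ℂ,
    z ^ (2 * m) • gEven q m A z
      - (∑ j ∈ Finset.range (2 * m), ((-1 : ℂ) ^ j * z ^ (2 * m - 1 - j)) • s j) * hEven q m A z
    = ∑ k ∈ Finset.range m, z ^ k • B k

/-- `s_0, ..., s_{2m}` are Markov parameters of the odd-degree polynomial with coefficients
`A`:  `z^(2m+1) h(z) - (∑_{j≤2m} (-1)^j s_j z^(2m-j)) z g(z)` has degree ≤ m. -/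
def MarkovOdd (q m : ℕ) (A s : ℕ → Mat q) : Prop :=
  ∃ B : ℕ → Mat q, ∀ z : ℂ,
    z ^ (2 * m + 1) • hOdd q m A z
      - (∑ j ∈ Finset.range (2 * m + 1), ((-1 : ℂ) ^ j * z ^ (2 * m - j)) • s j) *
          (z • gOdd q m A z)
    = ∑ k ∈ Finset.range (m + 1), z ^ k • B k

/-- The block Hankel matrix `H_{1,n-1} = (s_{i+j})_{i,j=0}^{n-1}` with `n` block rows. -/
def H1b (q : ℕ) (s : ℕ → Mat q) (n : ℕ) : Matrix (Fin n × Fin q) (Fin n × Fin q) ℂ :=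
  Matrix.of fun p r => s ((p.1 : ℕ) + (r.1 : ℕ)) p.2 r.2

/-- The block Hankel matrix `H_{2,n-1} = (s_{i+j+1})_{i,j=0}^{n-1}` with `n` block rows. -/
def H2b (q : ℕ) (s : ℕ → Mat q) (n : ℕ) : Matrix (Fin n × Fin q) (Fin n × Fin q) ℂ :=
  Matrix.of fun p r => s ((p.1 : ℕ) + (r.1 : ℕ) + 1) p.2 r.2

/-- The block column `Y_{1,n} = (s_n; s_{n+1}; ...; s_{2n-1})`. -/
def Y1b (q : ℕ) (s : ℕ → Mat q) (n : ℕ) : Matrix (Fin n × Fin q) (Fin q) ℂ :=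
  Matrix.of fun p b => s (n + (p.1 : ℕ)) p.2 b

/-- The block column `Y_{2,n} = (s_{n+1}; ...; s_{2n})`. -/
def Y2b (q : ℕ) (s : ℕ → Mat q) (n : ℕ) : Matrix (Fin n × Fin q) (Fin q) ℂ :=
  Matrix.of fun p b => s (n + 1 + (p.1 : ℕ)) p.2 b

/-- The block column `col (I, z I, ..., z^(n-1) I)`. -/
def colPow (q n : ℕ) (z : ℂ) : Matrix (Fin n × Fin q) (Fin q) ℂ :=
  Matrix.of fun p b => z ^ (p.1 : ℕ) * (if p.2 = b then 1 else 0)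

/-- `r_i(z) = ∑_{k=1}^{i} z^(i-k) s_{k-1}`. -/
def rPol (q : ℕ) (s : ℕ → Mat q) (i : ℕ) (z : ℂ) : Mat q :=
  ∑ k ∈ Finset.range i, z ^ (i - 1 - k) • s k

/-- `t_i(z) = ∑_{k=0}^{i} z^(i-k) s_k`. -/
def tPol (q : ℕ) (s : ℕ → Mat q) (i : ℕ) (z : ℂ) : Mat q :=
  ∑ k ∈ Finset.range (i + 1), z ^ (i - k) • s k

/-- The block column `col (r_0(z), ..., r_{n-1}(z))`. -/
def colR (q : ℕ) (s : ℕ → Mat q) (n : ℕ) (z : ℂ) : Matrix (Fin n × Fin q) (Fin q) ℂ :=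
  Matrix.of fun p b => rPol q s (p.1 : ℕ) z p.2 b

/-- The block column `col (t_0(z), ..., t_{n-1}(z))`. -/
def colT (q : ℕ) (s : ℕ → Mat q) (n : ℕ) (z : ℂ) : Matrix (Fin n × Fin q) (Fin q) ℂ :=
  Matrix.of fun p b => tPol q s (p.1 : ℕ) z p.2 b

/-- `P_{1,j}(z) = z^j I - Y_{1,j}^* H_{1,j-1}⁻¹ col(I, zI, ..., z^(j-1) I)`. -/
def P1 (q : ℕ) (s : ℕ → Mat q) (j : ℕ) (z : ℂ) : Mat q :=
  z ^ j • (1 : Mat q) - (Y1b q s j)ᴴ * (H1b q s j)⁻¹ * colPow q j z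

/-- `P_{2,j}(z) = z^j I - Y_{2,j}^* H_{2,j-1}⁻¹ col(I, zI, ..., z^(j-1) I)`. -/
def P2 (q : ℕ) (s : ℕ → Mat q) (j : ℕ) (z : ℂ) : Mat q :=
  z ^ j • (1 : Mat q) - (Y2b q s j)ᴴ * (H2b q s j)⁻¹ * colPow q j z

/-- `Q_{1,j}(z) = r_j(z) - Y_{1,j}^* H_{1,j-1}⁻¹ col(r_0(z), ..., r_{j-1}(z))`. -/
def Q1 (q : ℕ) (s : ℕ → Mat q) (j : ℕ) (z : ℂ) : Mat q :=
  rPol q s j z - (Y1b q s j)ᴴ * (H1b q s j)⁻¹ * colR q s j z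

/-- `Q_{2,j}(z) = t_j(z) - Y_{2,j}^* H_{2,j-1}⁻¹ col(t_0(z), ..., t_{j-1}(z))`. -/
def Q2 (q : ℕ) (s : ℕ → Mat q) (j : ℕ) (z : ℂ) : Mat q :=
  tPol q s j z - (Y2b q s j)ᴴ * (H2b q s j)⁻¹ * colT q s j z

/-- The block column `e = (I; 0; ...; 0)` with `n` blocks. -/
def eCol (q n : ℕ) : Matrix (Fin n × Fin q) (Fin q) ℂ :=
  Matrix.of fun p b => if (p.1 : ℕ) = 0 then (if p.2 = b then 1 else 0) else 0

/-- The block column `y = (s_0; s_1; ...; s_{n-1})`. -/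
def yCol (q : ℕ) (s : ℕ → Mat q) (n : ℕ) : Matrix (Fin n × Fin q) (Fin q) ℂ :=
  Matrix.of fun p b => s (p.1 : ℕ) p.2 b

/-- Condition C: `A_i^* A_k = A_k^* A_i` for every odd `i` and even `k` with `i, k ≤ n`. -/
def CondC (q n : ℕ) (A : ℕ → Mat q) : Prop :=
  ∀ i k, i ≤ n → k ≤ n → i % 2 = 1 → k % 2 = 0 → (A i)ᴴ * A k = (A k)ᴴ * A i

/-- The symmetrizer: for a polynomial with (descending) coefficients `Q_0, ..., Q_{n-1}`
(read off as `Q_j = A (2j)`), the `n × n` block Hankel matrix whose `(i,k)` block is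
`A (2(n-1-i-k))` if `i + k ≤ n - 1`, and `0` otherwise. -/
def Sh (q n : ℕ) (A : ℕ → Mat q) : Matrix (Fin n × Fin q) (Fin n × Fin q) ℂ :=
  Matrix.of fun p r =>
    if (p.1 : ℕ) + (r.1 : ℕ) ≤ n - 1 then A (2 * (n - 1 - (p.1 : ℕ) - (r.1 : ℕ))) p.2 r.2
    else 0

/-- The signature matrix `J̃ = diag (I, -I, I, ..., ±I)` with `n` blocks. -/
def Jt (q n : ℕ) : Matrix (Fin n × Fin q) (Fin n × Fin q) ℂ :=
  Matrix.diagonal (fun p => (-1 : ℂ) ^ (p.1 : ℕ))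

/-- The block row `(I, x² I, ..., x^(2n-2) I)`. -/
def Rev (q n : ℕ) (x : ℂ) : Matrix (Fin q) (Fin n × Fin q) ℂ :=
  Matrix.of fun a p => x ^ (2 * (p.1 : ℕ)) * (if a = p.2 then 1 else 0)

/-- The block column `(I; y² I; ...; y^(2n-2) I)`. -/
def Cev (q n : ℕ) (y : ℂ) : Matrix (Fin n × Fin q) (Fin q) ℂ :=
  Matrix.of fun p b => y ^ (2 * (p.1 : ℕ)) * (if p.2 = b then 1 else 0)

/-- The block row `(x I, x³ I, ..., x^(2n-1) I)`. -/
def Rod (q n : ℕ) (x : ℂ) : Matrix (Fin q) (Fin n × Fin q) ℂ :=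
  Matrix.of fun a p => x ^ (2 * (p.1 : ℕ) + 1) * (if a = p.2 then 1 else 0)

/-- The block column `(y I; y³ I; ...; y^(2n-1) I)`. -/
def Cod (q n : ℕ) (y : ℂ) : Matrix (Fin n × Fin q) (Fin q) ℂ :=
  Matrix.of fun p b => y ^ (2 * (p.1 : ℕ) + 1) * (if p.2 = b then 1 else 0)

section HornerTails

variable {𝕜 R : Type*} [CommRing 𝕜] [Ring R] [Algebra 𝕜 R]

/-- The `c`-th Horner tail `∑_d z^d G_{m-c-d}` of the polynomial `G_0 z^m + ... + G_m`. -/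
def hornerTail (m : ℕ) (G : ℕ → R) (z : 𝕜) (c : ℕ) : R :=
  ∑ d ∈ Finset.range (m + 1 - c), z ^ d • G (m - c - d)

theorem hornerTail_eq_smul_succ_add (m : ℕ) (G : ℕ → R) (z : 𝕜) {c : ℕ} (hc : c ≤ m) :
    hornerTail m G z c = z • hornerTail m G z (c + 1) + G (m - c) := by
  unfold hornerTail
  rw [show m + 1 - c = (m + 1 - (c + 1)) + 1 by omega, Finset.sum_range_succ', Finset.smul_sum]
  congr 1
  · refine Finset.sum_congr rfl fun d _ => ?_
    rw [smul_smul, ← pow_succ', show m - c - (d + 1) = m - (c + 1) - d by omega]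
  · simp

theorem hornerTail_self_succ (m : ℕ) (G : ℕ → R) (z : 𝕜) : hornerTail m G z (m + 1) = 0 := by
  simp [hornerTail]

theorem hornerTail_zero (m : ℕ) (G : ℕ → R) (z : 𝕜) :
    hornerTail m G z 0 = ∑ j ∈ Finset.range (m + 1), z ^ (m - j) • G j := by
  rw [← Finset.sum_range_reflect]
  refine Finset.sum_congr rfl fun d hd => ?_
  have := Finset.mem_range.1 hd
  rw [show m + 1 - 1 - d = m - d by omega, show m - (m - d) = d by omega, Nat.sub_zero]

theorem sum_mul_hornerTail {m : ℕ} {σ G H : ℕ → R} (z : 𝕜)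
    (hσ : ∀ d ≤ m, ∑ c ∈ Finset.range (d + 1), σ c * G (d - c) = H d) :
    ∑ c ∈ Finset.range (m + 1), σ c * hornerTail m G z c = hornerTail m H z 0 := by
  simp only [hornerTail, Finset.mul_sum, Nat.sub_zero]
  rw [Finset.sum_comm' (t' := Finset.range (m + 1)) (s' := fun d => Finset.range (m - d + 1))
    (by intro x y; simp only [Finset.mem_range]; omega)]
  refine Finset.sum_congr rfl fun d _ => ?_
  rw [← hσ (m - d) (by omega), Finset.smul_sum]
  refine Finset.sum_congr rfl fun c _ => ?_
  rw [mul_smul_comm, Nat.sub_right_comm]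

theorem sum_hornerTail_mul {m : ℕ} {σ G H : ℕ → R} (z : 𝕜)
    (hσ : ∀ d ≤ m, ∑ c ∈ Finset.range (d + 1), G (d - c) * σ c = H d) :
    ∑ c ∈ Finset.range (m + 1), hornerTail m G z c * σ c = hornerTail m H z 0 := by
  simp only [hornerTail, Finset.sum_mul, Nat.sub_zero]
  rw [Finset.sum_comm' (t' := Finset.range (m + 1)) (s' := fun d => Finset.range (m - d + 1))
    (by intro x y; simp only [Finset.mem_range]; omega)]
  refine Finset.sum_congr rfl fun d _ => ?_
  rw [← hσ (m - d) (by omega), Finset.smul_sum]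
  refine Finset.sum_congr rfl fun c _ => ?_
  rw [smul_mul_assoc, Nat.sub_right_comm]

/-- The `b`-th row of the shifted block Hankel matrix of `σ`, applied to the Horner tails. -/
def hankelTail (m : ℕ) (σ G : ℕ → R) (z : 𝕜) (b : ℕ) : R :=
  ∑ c ∈ Finset.range m, σ (b + c + 1) * hornerTail m G z (c + 1)

theorem mul_hornerTail_zero_add_hankelTail (m : ℕ) (σ G : ℕ → R) (z : 𝕜) (b : ℕ) :
    σ b * hornerTail m G z 0 + hankelTail m σ G z b
      = ∑ c ∈ Finset.range (m + 1), σ (b + c) * hornerTail m G z c := by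
  rw [Finset.sum_range_succ', add_comm]
  rfl

theorem smul_hankelTail {m : ℕ} {σ G : ℕ → R} (z : 𝕜) {b : ℕ}
    (hσ : ∑ c ∈ Finset.range (m + 1), σ (b + 1 + c) * G (m - c) = 0) :
    z • hankelTail m σ G z b
      = σ (b + 1) * hornerTail m G z 0 + hankelTail m σ G z (b + 1) := by
  rw [mul_hornerTail_zero_add_hankelTail]
  have key : ∑ c ∈ Finset.range (m + 1), σ (b + 1 + c) * hornerTail m G z c
      = ∑ c ∈ Finset.range (m + 1), z • (σ (b + 1 + c) * hornerTail m G z (c + 1))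
        + ∑ c ∈ Finset.range (m + 1), σ (b + 1 + c) * G (m - c) := by
    rw [← Finset.sum_add_distrib]
    refine Finset.sum_congr rfl fun c hc => ?_
    rw [hornerTail_eq_smul_succ_add m G z (Nat.lt_succ_iff.1 (Finset.mem_range.1 hc)), mul_add,
      mul_smul_comm]
  rw [key, hσ, add_zero, Finset.sum_range_succ, hornerTail_self_succ, mul_zero, smul_zero,
    add_zero, hankelTail, Finset.smul_sum]
  refine Finset.sum_congr rfl fun c _ => ?_
  rw [Nat.add_right_comm]

theorem sub_smul_sum_hornerTail_mul_hankelTail {m : ℕ} {σ G H G' H' : ℕ → R} (x y : 𝕜)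
    (hσ : ∀ d ≤ m, ∑ c ∈ Finset.range (d + 1), σ c * G (d - c) = H d)
    (hσ' : ∀ d ≤ m, ∑ c ∈ Finset.range (d + 1), G' (d - c) * σ c = H' d)
    (hσ0 : ∀ b < m, ∑ c ∈ Finset.range (m + 1), σ (b + 1 + c) * G (m - c) = 0) :
    (x - y) • ∑ b ∈ Finset.range m, hornerTail m G' x (b + 1) * hankelTail m σ G y b
      = hornerTail m G' x 0 * hornerTail m H y 0 - hornerTail m H' x 0 * hornerTail m G y 0
        - ∑ b ∈ Finset.range (m + 1), G' (m - b) * hankelTail m σ G y b := by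
  have hx : x • ∑ b ∈ Finset.range m, hornerTail m G' x (b + 1) * hankelTail m σ G y b
      = ∑ b ∈ Finset.range (m + 1), hornerTail m G' x b * hankelTail m σ G y b
        - ∑ b ∈ Finset.range (m + 1), G' (m - b) * hankelTail m σ G y b := by
    rw [← Finset.sum_sub_distrib, Finset.sum_range_succ,
      hornerTail_eq_smul_succ_add m G' x le_rfl, hornerTail_self_succ, smul_zero, zero_add,
      sub_self, add_zero, Finset.smul_sum]
    refine Finset.sum_congr rfl fun b hb => ?_
    rw [hornerTail_eq_smul_succ_add m G' x (Finset.mem_range.1 hb).le, add_mul,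
      add_sub_cancel_right, smul_mul_assoc]
  have hy : y • ∑ b ∈ Finset.range m, hornerTail m G' x (b + 1) * hankelTail m σ G y b
      = ∑ b ∈ Finset.range (m + 1), hornerTail m G' x b * hankelTail m σ G y b
        + hornerTail m H' x 0 * hornerTail m G y 0
        - hornerTail m G' x 0 * hornerTail m H y 0 := by
    have h0 : hornerTail m H y 0 = σ 0 * hornerTail m G y 0 + hankelTail m σ G y 0 := by
      rw [mul_hornerTail_zero_add_hankelTail, ← sum_mul_hornerTail y hσ]
      simp
    rw [← sum_hornerTail_mul x hσ', Finset.sum_mul, ← Finset.sum_add_distrib,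
      Finset.sum_range_succ', h0, Finset.smul_sum]
    have : ∀ b ∈ Finset.range m,
        y • (hornerTail m G' x (b + 1) * hankelTail m σ G y b)
          = hornerTail m G' x (b + 1) * hankelTail m σ G y (b + 1)
            + hornerTail m G' x (b + 1) * σ (b + 1) * hornerTail m G y 0 := by
      intro b hb
      rw [← mul_smul_comm, smul_hankelTail y (hσ0 b (Finset.mem_range.1 hb))]
      noncomm_ring
    rw [Finset.sum_congr rfl this]
    noncomm_ring
  rw [sub_smul, hx, hy]
  abel

theorem sub_smul_sum_hornerTail_mul_hankelTail_of_symm {m : ℕ} {σ G H G' H' : ℕ → R} (x y : 𝕜)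
    (hσ : ∀ d ≤ m, ∑ c ∈ Finset.range (d + 1), σ c * G (d - c) = H d)
    (hσ' : ∀ d ≤ m, ∑ c ∈ Finset.range (d + 1), G' (d - c) * σ c = H' d)
    (hσ0 : ∀ b < m, ∑ c ∈ Finset.range (m + 1), σ (b + 1 + c) * G (m - c) = 0)
    (hC : ∀ i ≤ m, ∀ k ≤ m, G' i * H k = H' k * G i) :
    (x - y) • ∑ b ∈ Finset.range m, hornerTail m G' x (b + 1) * hankelTail m σ G y b
      = hornerTail m G' x 0 * hornerTail m H y 0
        - hornerTail m H' x 0 * hornerTail m G y 0 := by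
  have hsymm : hornerTail m G' y 0 * hornerTail m H y 0
      = hornerTail m H' y 0 * hornerTail m G y 0 := by
    simp only [hornerTail_zero, Finset.sum_mul_sum]
    rw [Finset.sum_comm]
    refine Finset.sum_congr rfl fun k hk => Finset.sum_congr rfl fun i hi => ?_
    have hk := Finset.mem_range.1 hk
    have hi := Finset.mem_range.1 hi
    rw [smul_mul_smul_comm, smul_mul_smul_comm, hC i (by omega) k (by omega), mul_comm]
  have hdiag := sub_smul_sum_hornerTail_mul_hankelTail y y hσ hσ' hσ0
  rw [sub_self, zero_smul, hsymm, sub_self, zero_sub] at hdiag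
  rw [sub_smul_sum_hornerTail_mul_hankelTail x y hσ hσ' hσ0, neg_eq_zero.1 hdiag.symm, sub_zero]

theorem sub_smul_sum_hornerTail_mul_sum_of_symm {m : ℕ} {σ G H G' H' : ℕ → R} (x y : 𝕜)
    (hσ : ∀ d ≤ m, ∑ c ∈ Finset.range (d + 1), σ c * G (d - c) = H d)
    (hσ' : ∀ d ≤ m, ∑ c ∈ Finset.range (d + 1), G' (d - c) * σ c = H' d)
    (hσ0 : ∀ b < m, ∑ c ∈ Finset.range (m + 1), σ (b + 1 + c) * G (m - c) = 0)
    (hC : ∀ i ≤ m, ∀ k ≤ m, G' i * H k = H' k * G i) :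
    (x - y) • ∑ b ∈ Finset.range (m + 1), hornerTail m G' x b *
        ∑ c ∈ Finset.range (m + 1), σ (b + c) * hornerTail m G y c
      = x • (hornerTail m G' x 0 * hornerTail m H y 0)
        - y • (hornerTail m H' x 0 * hornerTail m G y 0) := by
  have hb : ∀ b ∈ Finset.range m, hornerTail m G' x (b + 1) *
        ∑ c ∈ Finset.range (m + 1), σ (b + 1 + c) * hornerTail m G y c
      = y • (hornerTail m G' x (b + 1) * hankelTail m σ G y b) := by
    intro b hb
    rw [← mul_smul_comm, smul_hankelTail y (hσ0 b (Finset.mem_range.1 hb)),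
      mul_hornerTail_zero_add_hankelTail]
  rw [Finset.sum_range_succ', Finset.sum_congr rfl hb, ← Finset.smul_sum]
  simp only [zero_add]
  rw [sum_mul_hornerTail y hσ, smul_add, smul_comm,
    sub_smul_sum_hornerTail_mul_hankelTail_of_symm x y hσ hσ' hσ0 hC]
  module

end HornerTails

section Coefficients

theorem sum_ite_eq_of_forall_sum_pow_smul {ι κ τ a b : Type*} (S : Finset ι) (T : Finset κ)
    (W : Finset τ) (e : ι → ℕ) (e' : κ → ℕ) (e'' : τ → ℕ) (C : ι → Matrix a b ℂ)
    (D : κ → Matrix a b ℂ) (E : τ → Matrix a b ℂ)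
    (h : ∀ z : ℂ, ∑ i ∈ S, z ^ e i • C i - ∑ i ∈ T, z ^ e' i • D i = ∑ i ∈ W, z ^ e'' i • E i)
    (N : ℕ) :
    (∑ i ∈ S, if e i = N then C i else 0) - (∑ i ∈ T, if e' i = N then D i else 0)
      = ∑ i ∈ W, if e'' i = N then E i else 0 := by
  ext r t
  have hp : ∑ i ∈ S, Polynomial.monomial (e i) (C i r t)
      - ∑ i ∈ T, Polynomial.monomial (e' i) (D i r t)
      = ∑ i ∈ W, Polynomial.monomial (e'' i) (E i r t) := by
    refine Polynomial.funext fun z => ?_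
    have := congrFun (congrFun (h z) r) t
    simpa [Polynomial.eval_finsetSum, Matrix.sum_apply, mul_comm] using this
  have := congrArg (fun p => p.coeff N) hp
  simpa [Polynomial.finsetSum_coeff, Polynomial.coeff_monomial, Matrix.sum_apply,
    apply_ite (fun M : Matrix a b ℂ => M r t)] using this

variable {q m : ℕ} {A s : ℕ → Mat q}

theorem MarkovOdd.sum_eq (hM : MarkovOdd q m A s) {k : ℕ} (hk : k ≤ 2 * m) :
    (∑ i ∈ Finset.range (m + 1),
        if i ≤ k then ((-1 : ℂ) ^ (k - i) • s (k - i)) * A (2 * i) else 0)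
      = if k ≤ m then A (2 * k + 1) else 0 := by
  obtain ⟨B, hB⟩ := hM
  have h := sum_ite_eq_of_forall_sum_pow_smul (Finset.range (m + 1))
    (Finset.range (m + 1) ×ˢ Finset.range (2 * m + 1)) (Finset.range (m + 1))
    (fun i => 2 * m + 1 + (m - i)) (fun p => 2 * m - p.2 + 1 + (m - p.1)) (fun i => i)
    (fun i => A (2 * i + 1)) (fun p => ((-1 : ℂ) ^ p.2 • s p.2) * A (2 * p.1)) B
    (fun z => by
      rw [← hB z, hOdd, gOdd, Finset.smul_sum, Finset.smul_sum, Finset.sum_mul_sum,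
        Finset.sum_product_right]
      congr 1
      · exact Finset.sum_congr rfl fun i _ => by rw [smul_smul, pow_add]
      · refine Finset.sum_congr rfl fun j _ => Finset.sum_congr rfl fun i _ => ?_
        rw [smul_smul, smul_mul_smul_comm, smul_mul_assoc, smul_smul]
        congr 1
        ring) (3 * m + 1 - k)
  rw [Finset.sum_product, Finset.sum_eq_zero (s := Finset.range (m + 1))
    (f := fun i => if i = 3 * m + 1 - k then B i else 0), sub_eq_zero] at h
  · calc _ = _ := ?_
      _ = _ := h.symm
      _ = _ := ?_
    · refine Finset.sum_congr rfl fun i hi => ?_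
      have hi := Finset.mem_range.1 hi
      by_cases hik : i ≤ k
      · rw [if_pos hik, Finset.sum_eq_single (k - i)]
        · rw [if_pos (by dsimp only; omega)]
        · intro j hj hne
          have := Finset.mem_range.1 hj
          rw [if_neg (by dsimp only; omega)]
        · intro hj
          exact absurd (Finset.mem_range.2 (by omega)) hj
      · rw [if_neg hik, Finset.sum_eq_zero]
        intro j hj
        have := Finset.mem_range.1 hj
        rw [if_neg (by dsimp only; omega)]
    · by_cases hkm : k ≤ m
      · rw [if_pos hkm, Finset.sum_eq_single k]
        · rw [if_pos (by omega)]
        · intro j hj hne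
          have := Finset.mem_range.1 hj
          rw [if_neg (by omega)]
        · intro hj
          exact absurd (Finset.mem_range.2 (by omega)) hj
      · rw [if_neg hkm, Finset.sum_eq_zero]
        intro j hj
        have := Finset.mem_range.1 hj
        rw [if_neg (by omega)]
  · intro i hi
    have := Finset.mem_range.1 hi
    rw [if_neg (by omega)]

theorem MarkovOdd.sum_mul_eq (hM : MarkovOdd q m A s) {d : ℕ} (hd : d ≤ m) :
    ∑ c ∈ Finset.range (d + 1), ((-1 : ℂ) ^ c • s c) * A (2 * (d - c)) = A (2 * d + 1) := by
  have h := hM.sum_eq (k := d) (by omega)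
  rw [if_pos hd, ← Finset.sum_filter,
    show (Finset.range (m + 1)).filter (· ≤ d) = Finset.range (d + 1) by ext; simp; omega,
    ← Finset.sum_range_reflect] at h
  rw [← h]
  refine Finset.sum_congr rfl fun c hc => ?_
  have := Finset.mem_range.1 hc
  rw [show d + 1 - 1 - c = d - c by omega, show d - (d - c) = c by omega]

theorem MarkovOdd.sum_mul_eq_zero (hM : MarkovOdd q m A s) {b : ℕ} (hb : b < m) :
    ∑ c ∈ Finset.range (m + 1),
        ((-1 : ℂ) ^ (b + 1 + c) • s (b + 1 + c)) * A (2 * (m - c)) = 0 := by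
  have h := hM.sum_eq (k := b + 1 + m) (by omega)
  rw [if_neg (by omega), ← Finset.sum_range_reflect] at h
  rw [← h]
  refine Finset.sum_congr rfl fun c hc => ?_
  have := Finset.mem_range.1 hc
  rw [if_pos (by omega), show m + 1 - 1 - c = m - c by omega,
    show b + 1 + m - (m - c) = b + 1 + c by omega]

theorem MarkovOdd.sum_conjTranspose_mul_eq (hM : MarkovOdd q m A s)
    (hherm : ∀ j ≤ 2 * m, (s j).IsHermitian) {d : ℕ} (hd : d ≤ m) :
    ∑ c ∈ Finset.range (d + 1), (A (2 * (d - c)))ᴴ * ((-1 : ℂ) ^ c • s c) = (A (2 * d + 1))ᴴ := by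
  rw [← hM.sum_mul_eq hd, Matrix.conjTranspose_sum]
  refine Finset.sum_congr rfl fun c hc => ?_
  have := Finset.mem_range.1 hc
  rw [Matrix.conjTranspose_mul, Matrix.conjTranspose_smul, (hherm c (by omega)).eq]
  simp

end Coefficients

section Blocks

variable {q : ℕ}

/-- The block column with blocks `F 0, ..., F (n-1)`. -/
def blockCol (n : ℕ) (F : ℕ → Mat q) : Matrix (Fin n × Fin q) (Fin q) ℂ :=
  Matrix.of fun p b => F p.1 p.2 b

/-- The block row with blocks `F 0, ..., F (n-1)`. -/
def blockRow (n : ℕ) (F : ℕ → Mat q) : Matrix (Fin q) (Fin n × Fin q) ℂ :=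
  Matrix.of fun a p => F p.1 a p.2

theorem blockRow_mul_blockCol (n : ℕ) (F G : ℕ → Mat q) :
    blockRow n F * blockCol n G = ∑ i ∈ Finset.range n, F i * G i := by
  ext a b
  simp [blockRow, blockCol, Matrix.mul_apply, Fintype.sum_prod_type, Matrix.sum_apply,
    Finset.sum_range]

theorem Jt_mul_blockCol (n : ℕ) (G : ℕ → Mat q) :
    Jt q n * blockCol n G = blockCol n fun i => (-1 : ℂ) ^ i • G i := by
  ext p b
  simp [Jt, blockCol, Matrix.diagonal_mul]

theorem H1b_mul_blockCol (n : ℕ) (s G : ℕ → Mat q) :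
    H1b q s n * blockCol n G = blockCol n fun i => ∑ k ∈ Finset.range n, s (i + k) * G k := by
  ext p b
  simp [H1b, blockCol, Matrix.mul_apply, Fintype.sum_prod_type, Matrix.sum_apply,
    Finset.sum_range]

theorem H2b_mul_blockCol (n : ℕ) (s G : ℕ → Mat q) :
    H2b q s n * blockCol n G = blockCol n fun i => ∑ k ∈ Finset.range n, s (i + k + 1) * G k := by
  ext p b
  simp [H2b, blockCol, Matrix.mul_apply, Fintype.sum_prod_type, Matrix.sum_apply,
    Finset.sum_range]

/-- Rows of the symmetrizer, paired with powers, are Horner tails. -/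
theorem sum_fin_pow_mul_Sh_eq (m : ℕ) (A : ℕ → Mat q) (z : ℂ) (i : Fin (m + 1)) :
    ∑ k : Fin (m + 1), z ^ (k : ℕ) •
        (if (i : ℕ) + k ≤ m then A (2 * (m - i - k)) else 0)
      = hornerTail m (fun j => A (2 * j)) z i := by
  rw [hornerTail, ← Finset.sum_range (fun k => z ^ k •
    (if (i : ℕ) + k ≤ m then A (2 * (m - i - k)) else 0))]
  simp only [smul_ite, smul_zero]
  rw [← Finset.sum_filter]
  refine Finset.sum_congr ?_ fun _ _ => rfl
  ext
  simp
  omega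

theorem Sh_mul_Cev (m : ℕ) (A : ℕ → Mat q) (y : ℂ) :
    Sh q (m + 1) A * Cev q (m + 1) y
      = blockCol (m + 1) (hornerTail m (fun j => A (2 * j)) (y ^ 2)) := by
  ext p b
  simp [Sh, Cev, blockCol, ← sum_fin_pow_mul_Sh_eq, Matrix.mul_apply, Fintype.sum_prod_type,
    Matrix.sum_apply, pow_mul, mul_comm (_ : ℂ) ((y ^ 2) ^ _),
    apply_ite (fun M : Mat q => M p.2 b)]

theorem Rev_mul_Sh (m : ℕ) (A : ℕ → Mat q) (x : ℂ) :
    Rev q (m + 1) x * Sh q (m + 1) A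
      = blockRow (m + 1) (hornerTail m (fun j => A (2 * j)) (x ^ 2)) := by
  ext a p
  simp [Sh, Rev, blockRow, ← sum_fin_pow_mul_Sh_eq, Matrix.mul_apply, Fintype.sum_prod_type,
    Matrix.sum_apply, pow_mul, apply_ite (fun M : Mat q => M a p.2), add_comm,
    Nat.sub_right_comm]

theorem Cod_eq_smul_Cev (n : ℕ) (y : ℂ) : Cod q n y = y • Cev q n y := by
  ext p b
  simp [Cod, Cev, pow_succ']

theorem Rod_eq_smul_Rev (n : ℕ) (x : ℂ) : Rod q n x = x • Rev q n x := by
  ext a p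
  simp [Rod, Rev, pow_succ']

theorem hornerTail_succ_succ {𝕜 R : Type*} [CommRing 𝕜] [Ring R] [Algebra 𝕜 R] (m : ℕ)
    (G : ℕ → R) (z : 𝕜) (c : ℕ) : hornerTail (m + 1) G z (c + 1) = hornerTail m G z c := by
  simp only [hornerTail, Nat.add_sub_add_right]

theorem gOdd_eq_hornerTail (m : ℕ) (A : ℕ → Mat q) (z : ℂ) :
    gOdd q m A z = hornerTail m (fun j => A (2 * j)) z 0 := by
  rw [hornerTail_zero, gOdd]

theorem hOdd_eq_hornerTail (m : ℕ) (A : ℕ → Mat q) (z : ℂ) :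
    hOdd q m A z = hornerTail m (fun j => A (2 * j + 1)) z 0 := by
  rw [hornerTail_zero, hOdd]

theorem conjTranspose_hornerTail_conj (m : ℕ) (G : ℕ → Mat q) (z : ℂ) (c : ℕ) :
    (hornerTail m G ((starRingEnd ℂ) z) c)ᴴ = hornerTail m (fun j => (G j)ᴴ) z c := by
  simp [hornerTail, Matrix.conjTranspose_sum, Matrix.conjTranspose_smul]

end Blocks

theorem stmt_12 (q m : ℕ) (hq : 1 ≤ q) (hm : 1 ≤ m) (A s : ℕ → Mat q)
    (hA0 : (A 0).det ≠ 0) (hC : CondC q (2 * m + 1) A)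
    (hherm : ∀ j ≤ 2 * m, (s j).IsHermitian) (hM : MarkovOdd q m A s) :
    ∀ x y : ℂ,
      (x ^ 2 • ((gOdd q m A ((starRingEnd ℂ) (x ^ 2)))ᴴ * hOdd q m A (y ^ 2))
          - y ^ 2 • ((hOdd q m A ((starRingEnd ℂ) (x ^ 2)))ᴴ * gOdd q m A (y ^ 2))
        = (x ^ 2 - y ^ 2) •
            (Rev q (m + 1) x * (Sh q (m + 1) (fun i => (A i)ᴴ) * (Jt q (m + 1) *
              (H1b q s (m + 1) * (Jt q (m + 1) * (Sh q (m + 1) A * Cev q (m + 1) y))))))) ∧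
      ((x * y) • ((gOdd q m A ((starRingEnd ℂ) (x ^ 2)))ᴴ * hOdd q m A (y ^ 2)
            - (hOdd q m A ((starRingEnd ℂ) (x ^ 2)))ᴴ * gOdd q m A (y ^ 2))
        = -((x ^ 2 - y ^ 2) •
            (Rod q m x * (Sh q m (fun i => (A i)ᴴ) * (Jt q m * (H2b q s m *
              (Jt q m * (Sh q m A * Cod q m y)))))))) := by
  intro x y
  set σ : ℕ → Mat q := fun j => (-1 : ℂ) ^ j • s j with hσdef
  have hσ := fun d (hd : d ≤ m) => hM.sum_mul_eq hd
  have hσ' := fun d (hd : d ≤ m) => hM.sum_conjTranspose_mul_eq hherm hd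
  have hσ0 := fun b (hb : b < m) => hM.sum_mul_eq_zero hb
  have hsymm : ∀ i ≤ m, ∀ k ≤ m,
      (A (2 * i))ᴴ * A (2 * k + 1) = (A (2 * k + 1))ᴴ * A (2 * i) := fun i hi k hk =>
    (hC (2 * k + 1) (2 * i) (by omega) (by omega) (by omega) (by omega)).symm
  rw [gOdd_eq_hornerTail, gOdd_eq_hornerTail, hOdd_eq_hornerTail, hOdd_eq_hornerTail,
    conjTranspose_hornerTail_conj, conjTranspose_hornerTail_conj]
  constructor
  · rw [← sub_smul_sum_hornerTail_mul_sum_of_symm (σ := σ) (G := fun j => A (2 * j))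
        (G' := fun j => (A (2 * j))ᴴ) (x ^ 2) (y ^ 2) hσ hσ' hσ0 hsymm,
      Sh_mul_Cev, Jt_mul_blockCol, H1b_mul_blockCol, Jt_mul_blockCol, ← Matrix.mul_assoc,
      Rev_mul_Sh, blockRow_mul_blockCol]
    congr 1
    refine Finset.sum_congr rfl fun b _ => ?_
    rw [Finset.smul_sum]
    congr 1
    refine Finset.sum_congr rfl fun c _ => ?_
    rw [mul_smul_comm, smul_smul, hσdef, smul_mul_assoc, pow_add]
  · obtain ⟨n, rfl⟩ : ∃ n, m = n + 1 := ⟨m - 1, by omega⟩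
    rw [← sub_smul_sum_hornerTail_mul_hankelTail_of_symm (σ := σ) (G := fun j => A (2 * j))
        (G' := fun j => (A (2 * j))ᴴ) (x ^ 2) (y ^ 2) hσ hσ' hσ0 hsymm,
      Cod_eq_smul_Cev, Rod_eq_smul_Rev]
    simp only [Matrix.mul_smul, Matrix.smul_mul]
    rw [Sh_mul_Cev, Jt_mul_blockCol, H2b_mul_blockCol, Jt_mul_blockCol, ← Matrix.mul_assoc,
      Rev_mul_Sh, blockRow_mul_blockCol, smul_smul y x, mul_comm y x, smul_comm (x * y),
      ← smul_neg, ← smul_neg, ← Finset.sum_neg_distrib]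
    congr 2
    refine Finset.sum_congr rfl fun b _ => ?_
    rw [hornerTail_succ_succ, hankelTail, Finset.smul_sum, ← mul_neg, ← Finset.sum_neg_distrib]
    congr 1
    refine Finset.sum_congr rfl fun c _ => ?_
    rw [hornerTail_succ_succ, mul_smul_comm, smul_smul, hσdef, smul_mul_assoc, ← neg_smul,
      ← pow_add, pow_succ]
    simp

end
end

section
/- Let f be a Hurwitz-type matrix (HTM) polynomial of degree 2m whose coefficients satisfy Condition C. Then f is a Hurwitz matrix polynomial: every root of the scalar polynomial det f(z) has negative real part. -/
open Matrix MeasureTheory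
open scoped ComplexOrder

noncomputable section

open Polynomial in
/-- A matrix-valued function whose entries are polynomial functions. -/
def IsPolyMat {q : ℕ} (F : ℂ → Mat q) : Prop :=
  ∃ M : Matrix (Fin q) (Fin q) ℂ[X], ∀ z, F z = (evalRingHom z).mapMatrix M

namespace IsPolyMat

open Filter Topology Polynomial

variable {q : ℕ} {F G : ℂ → Mat q}

lemma const (a : Mat q) : IsPolyMat fun _ => a :=
  ⟨a.map C, fun z => by ext; simp⟩

lemma sub (hF : IsPolyMat F) (hG : IsPolyMat G) : IsPolyMat fun z => F z - G z := by
  obtain ⟨M, hM⟩ := hF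
  obtain ⟨N, hN⟩ := hG
  exact ⟨M - N, fun z => by simp only [hM, hN, map_sub]⟩

lemma mul (hF : IsPolyMat F) (hG : IsPolyMat G) : IsPolyMat fun z => F z * G z := by
  obtain ⟨M, hM⟩ := hF
  obtain ⟨N, hN⟩ := hG
  exact ⟨M * N, fun z => by simp only [hM, hN, map_mul]⟩

lemma id_smul (hF : IsPolyMat F) : IsPolyMat fun z => z • F z := by
  obtain ⟨M, hM⟩ := hF
  exact ⟨(X : ℂ[X]) • M, fun z => by ext; simp [hM]⟩

lemma sum_pow_smul (n : ℕ) (e : ℕ → ℕ) (B : ℕ → Mat q) :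
    IsPolyMat fun z => ∑ j ∈ Finset.range n, z ^ e j • B j :=
  ⟨∑ j ∈ Finset.range n, (X ^ e j : ℂ[X]) • (B j).map C, fun z => by
    ext i j
    simp only [RingHom.mapMatrix_apply, map_apply, Matrix.sum_apply, map_sum]
    exact Finset.sum_congr rfl fun _ _ => by
      simp only [Matrix.smul_apply, smul_eq_mul, map_apply, map_mul, map_pow, coe_evalRingHom,
        eval_X, eval_C]⟩

lemma exists_det (hF : IsPolyMat F) : ∃ p : ℂ[X], ∀ z, (F z).det = p.eval z := by
  obtain ⟨M, hM⟩ := hF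
  exact ⟨M.det, fun z => by rw [hM, ← RingHom.map_det, coe_evalRingHom]⟩

/-- A polynomial matrix vanishing at all large natural numbers is zero. -/
lemma eq_zero_of_eventually (hF : IsPolyMat F) (h : ∀ᶠ n : ℕ in atTop, F n = 0) (z : ℂ) :
    F z = 0 := by
  obtain ⟨M, hM⟩ := hF
  have hM0 : M = 0 := by
    ext1 i j
    refine eq_zero_of_infinite_isRoot _ ?_
    have hinf : {n : ℕ | F n = 0}.Infinite := Nat.frequently_atTop_iff_infinite.mp h.frequently
    refine (hinf.image (Nat.cast_injective (R := ℂ)).injOn).mono ?_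
    rintro _ ⟨n, hn, rfl⟩
    have := congrFun (congrFun ((hM n).symm.trans hn) i) j
    simpa using this
  rw [hM, hM0, map_zero]

end IsPolyMat

/-- The Euclidean-type recursion `p_{k+1} = p_k - z c_k q_k`, `q_{k+1} = q_k - d_k p_{k+1}`
started from `(p_0, q_0) = (h, g)`. -/
def euclidPair {q : ℕ} (c d : ℕ → Mat q) (h g : ℂ → Mat q) : ℕ → ℂ → Mat q × Mat q
  | 0, z => (h z, g z)
  | k + 1, z =>
    ((euclidPair c d h g k z).1 - z • (c k * (euclidPair c d h g k z).2),
      (euclidPair c d h g k z).2 -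
        d k * ((euclidPair c d h g k z).1 - z • (c k * (euclidPair c d h g k z).2)))

section

open Filter Topology Polynomial

variable {q m : ℕ} {c d : ℕ → Mat q} {h g : ℂ → Mat q}

lemma euclidPair_fst (k : ℕ) (z : ℂ) :
    (euclidPair c d h g k z).1 =
      z • (c k * (euclidPair c d h g k z).2) + (euclidPair c d h g (k + 1) z).1 := by
  simp [euclidPair]

lemma euclidPair_snd (k : ℕ) (z : ℂ) :
    (euclidPair c d h g k z).2 =
      d k * (euclidPair c d h g (k + 1) z).1 + (euclidPair c d h g (k + 1) z).2 := by
  simp [euclidPair]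

lemma euclidPair_fst_zero (k : ℕ) : (euclidPair c d h g k 0).1 = h 0 := by
  induction k with
  | zero => rfl
  | succ k ih => simpa [euclidPair] using ih

lemma isPolyMat_euclidPair (hh : IsPolyMat h) (hg : IsPolyMat g) (k : ℕ) :
    IsPolyMat (fun z => (euclidPair c d h g k z).1) ∧
      IsPolyMat (fun z => (euclidPair c d h g k z).2) := by
  induction k with
  | zero => exact ⟨hh, hg⟩
  | succ k ih =>
    have h1 := ih.1.sub ((IsPolyMat.const (c k)).mul ih.2).id_smul
    exact ⟨h1, ih.2.sub ((IsPolyMat.const (d k)).mul h1)⟩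

lemma wEven_posDef (hc : ∀ k < m, (c k).PosDef) (hd : ∀ k < m, (d k).PosDef) {t : ℂ}
    (ht : 0 < t) (j : ℕ) (hj : j < m) : (wEven q m c d j t).PosDef := by
  induction j with
  | zero => exact ((hc _ (by omega)).smul ht).add (hd _ (by omega)).inv
  | succ j ih =>
    exact ((hc _ (by omega)).smul ht).add ((hd _ (by omega)).add (ih (by omega)).inv).inv

/-- At a point where the continued fraction expansion holds, the recursion follows it. -/
lemma euclidPair_fst_eq_wEven_mul (hc : ∀ k < m, (c k).PosDef) (hd : ∀ k < m, (d k).PosDef)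
    {t : ℂ} (ht : 0 < t) (h0 : h t = wEven q m c d (m - 1) t * g t) (k : ℕ) (hk : k < m) :
    (euclidPair c d h g k t).1 =
      wEven q m c d (m - 1 - k) t * (euclidPair c d h g k t).2 := by
  induction k with
  | zero => exact h0
  | succ k ih =>
    specialize ih (by omega)
    obtain ⟨j, hj⟩ : ∃ j, m - 1 - k = j + 1 := ⟨m - 2 - k, by omega⟩
    have hjk : m - 2 - j = k := by omega
    have hw := wEven_posDef hc hd ht j (by omega)
    have hD : (d k + (wEven q m c d j t)⁻¹).PosDef := (hd k (by omega)).add hw.inv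
    rw [hj, wEven, hjk] at ih
    have hp : (euclidPair c d h g (k + 1) t).1 =
        (d k + (wEven q m c d j t)⁻¹)⁻¹ * (euclidPair c d h g k t).2 := by
      rw [euclidPair, ih, add_mul, smul_mul_assoc, add_sub_cancel_left]
    have hq : (euclidPair c d h g (k + 1) t).2 =
        (wEven q m c d j t)⁻¹ * (euclidPair c d h g (k + 1) t).1 := by
      have h1 : (d k + (wEven q m c d j t)⁻¹) * (euclidPair c d h g (k + 1) t).1 =
          (euclidPair c d h g k t).2 := by
        rw [hp, Matrix.mul_nonsing_inv_cancel_left _ _ ((isUnit_iff_isUnit_det _).mp hD.isUnit)]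
      rw [euclidPair_snd k t, add_mul] at h1
      exact (add_left_cancel h1).symm
    rw [show m - 1 - (k + 1) = j by omega, hq,
      Matrix.mul_nonsing_inv_cancel_left _ _ ((isUnit_iff_isUnit_det _).mp hw.isUnit)]

lemma euclidPair_snd_eq_zero (hm : 1 ≤ m) (hc : ∀ k < m, (c k).PosDef)
    (hd : ∀ k < m, (d k).PosDef) {t : ℂ} (ht : 0 < t)
    (h0 : h t = wEven q m c d (m - 1) t * g t) : (euclidPair c d h g m t).2 = 0 := by
  obtain ⟨n, rfl⟩ : ∃ n, m = n + 1 := ⟨m - 1, by omega⟩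
  have hp := euclidPair_fst_eq_wEven_mul hc hd ht h0 n (by omega)
  rw [show n + 1 - 1 - n = 0 by omega, wEven, show n + 1 - 1 = n by omega] at hp
  rw [euclidPair, hp, add_mul, smul_mul_assoc, add_sub_cancel_left,
    Matrix.mul_nonsing_inv_cancel_left _ _
      ((isUnit_iff_isUnit_det _).mp (hd n (by omega)).isUnit), sub_self]

/-- If the recursion terminates, the initial matrix `h` is a right multiple of the last one by a
factor of degree `m` with invertible leading coefficient. -/
lemma exists_factor_euclidPair (hc : ∀ k < m, (c k).PosDef) (hd : ∀ k < m, (d k).PosDef)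
    (hlast : ∀ z, (euclidPair c d h g m z).2 = 0) (j : ℕ) (hj : j ≤ m) :
    ∃ (P Q : ℂ → Mat q) (L : Mat q),
      (∀ z, (euclidPair c d h g (m - j) z).1 = P z * (euclidPair c d h g m z).1) ∧
      (∀ z, (euclidPair c d h g (m - j) z).2 = Q z * (euclidPair c d h g m z).1) ∧
      L.det ≠ 0 ∧
      Tendsto (fun n : ℕ => ((n : ℂ)⁻¹) ^ j • P n) atTop (𝓝 L) ∧
      Tendsto (fun n : ℕ => ((n : ℂ)⁻¹) ^ j • Q n) atTop (𝓝 0) := by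
  have hinv : Tendsto (fun n : ℕ => (n : ℂ)⁻¹) atTop (𝓝 0) :=
    tendsto_inv_atTop_nhds_zero_nat (𝕜 := ℂ)
  induction j with
  | zero => exact ⟨fun _ => 1, fun _ => 0, 1, by simp, by simp [hlast], by simp, by simp, by simp⟩
  | succ j ih =>
    obtain ⟨P, Q, L, hP, hQ, hL, hPL, hQ0⟩ := ih (by omega)
    obtain ⟨k, hk⟩ : ∃ k, k = m - (j + 1) := ⟨_, rfl⟩
    have hk1 : m - j = k + 1 := by omega
    rw [hk1] at hP hQ
    rw [← hk]
    have hcu := (isUnit_iff_isUnit_det _).mp (hc k (by omega)).isUnit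
    have hdu := (isUnit_iff_isUnit_det _).mp (hd k (by omega)).isUnit
    have hQ' : Tendsto (fun n : ℕ => ((n : ℂ)⁻¹) ^ j • (d k * P n + Q n)) atTop
        (𝓝 (d k * L)) := by
      have := (tendsto_const_nhds (x := d k)).mul hPL |>.add hQ0
      rw [add_zero] at this
      refine this.congr fun n => ?_
      rw [smul_add, mul_smul_comm]
    refine ⟨fun z => z • (c k * (d k * P z + Q z)) + P z, fun z => d k * P z + Q z,
      c k * (d k * L), fun z => ?_, fun z => ?_, ?_, ?_, ?_⟩
    · rw [euclidPair_fst, euclidPair_snd, hP, hQ]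
      simp only [add_mul, mul_add, smul_mul_assoc, mul_assoc]
    · rw [euclidPair_snd, hP, hQ]
      simp only [add_mul, mul_assoc]
    · rw [det_mul, det_mul]
      exact mul_ne_zero hcu.ne_zero (mul_ne_zero hdu.ne_zero hL)
    · have := ((tendsto_const_nhds (x := c k)).mul hQ').add (hinv.smul hPL)
      rw [zero_smul, add_zero] at this
      refine this.congr' ?_
      filter_upwards [eventually_ne_atTop 0] with n hn
      have hn' : (n : ℂ) ≠ 0 := Nat.cast_ne_zero.mpr hn
      rw [smul_add (_ ^ (j + 1)), smul_smul _ (n : ℂ), smul_smul (n : ℂ)⁻¹, pow_succ,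
        inv_mul_cancel_right₀ hn', mul_smul_comm, mul_comm (n : ℂ)⁻¹]
    · have := hinv.smul hQ'
      rw [zero_smul] at this
      refine this.congr fun n => ?_
      rw [smul_smul, pow_succ']

lemma Polynomial.eval_ne_zero_of_tendsto {p : ℂ[X]} {a : ℂ} (ha : a ≠ 0)
    (h : Tendsto (fun n : ℕ => p.eval (n : ℂ)) atTop (𝓝 a)) (z : ℂ) : p.eval z ≠ 0 := by
  have hdeg : p.degree ≤ 0 := by
    by_contra! hlt
    refine not_tendsto_nhds_of_tendsto_atTop
      (p.tendsto_norm_atTop hlt (z := fun n : ℕ => (n : ℂ)) (l := atTop) ?_) _ h.norm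
    simpa using tendsto_natCast_atTop_atTop (R := ℝ)
  rw [eq_C_of_degree_le_zero hdeg] at h ⊢
  simp only [eval_C] at h ⊢
  rwa [tendsto_nhds_unique tendsto_const_nhds h]

lemma det_euclidPair_ne_zero (hc : ∀ k < m, (c k).PosDef) (hd : ∀ k < m, (d k).PosDef)
    (hh : IsPolyMat h) (hg : IsPolyMat g) (hlast : ∀ z, (euclidPair c d h g m z).2 = 0)
    {a : Mat q} (ha : a.det ≠ 0)
    (hlim : Tendsto (fun n : ℕ => ((n : ℂ)⁻¹) ^ m • h n) atTop (𝓝 a)) (z : ℂ) :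
    (euclidPair c d h g m z).1.det ≠ 0 := by
  obtain ⟨P, -, L, hP, -, hL, hPL, -⟩ := exists_factor_euclidPair hc hd hlast m le_rfl
  obtain ⟨p, hp⟩ := (isPolyMat_euclidPair (c := c) (d := d) hh hg m).1.exists_det
  simp only [Nat.sub_self, euclidPair] at hP
  have hdet : Continuous fun M : Mat q => M.det := continuous_id.matrix_det
  have h1 := (hdet.tendsto a).comp hlim
  have h2 := (hdet.tendsto L).comp hPL
  rw [hp]
  refine Polynomial.eval_ne_zero_of_tendsto (div_ne_zero ha hL) ((h1.div h2 hL).congr' ?_) z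
  filter_upwards [h2.eventually_ne hL] with n hn
  simp only [Function.comp_apply, Pi.div_apply] at hn ⊢
  rw [div_eq_iff hn, hP, ← smul_mul_assoc, det_mul, hp, mul_comm]

/-- The energy inequality: the real part of `⟨p_k v, z q_k v⟩` is nonincreasing in `k`. -/
lemma re_euclidPair_nonneg (hc : ∀ k < m, (c k).PosDef) (hd : ∀ k < m, (d k).PosDef)
    (hlast : ∀ z, (euclidPair c d h g m z).2 = 0) {z : ℂ} (hz : 0 ≤ z.re) (v : Fin q → ℂ)
    (k : ℕ) (hk : k ≤ m) :
    0 ≤ (star ((euclidPair c d h g k (z ^ 2)).1 *ᵥ v) ⬝ᵥ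
      (z • ((euclidPair c d h g k (z ^ 2)).2 *ᵥ v))).re := by
  induction hk using Nat.decreasingInduction with
  | self => simp [hlast]
  | of_succ k hk ih =>
    set p := (euclidPair c d h g (k + 1) (z ^ 2)).1 *ᵥ v with hp
    set r := (euclidPair c d h g (k + 1) (z ^ 2)).2 *ᵥ v with hr
    set y := (euclidPair c d h g k (z ^ 2)).2 *ᵥ v with hy
    have hx : (euclidPair c d h g k (z ^ 2)).1 *ᵥ v = z • (c k *ᵥ (z • y)) + p := by
      rw [euclidPair_fst, add_mulVec, smul_mulVec, ← mulVec_mulVec, mulVec_smul, smul_smul, ← pow_two]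
    have hy' : y = d k *ᵥ p + r := by
      rw [hy, euclidPair_snd, add_mulVec, ← mulVec_mulVec]
    have hc1 := (hc k hk).posSemidef.dotProduct_mulVec_nonneg (z • y)
    have hd1 := (hd k hk).posSemidef.dotProduct_mulVec_nonneg p
    have hcs : star (c k *ᵥ (z • y)) ⬝ᵥ (z • y) = star (z • y) ⬝ᵥ (c k *ᵥ (z • y)) := by
      rw [star_mulVec, (hc k hk).isHermitian.eq, dotProduct_mulVec]
    rw [hx, star_add, add_dotProduct, star_smul, smul_dotProduct, hcs]
    have hpy : star p ⬝ᵥ (z • y) = z * (star p ⬝ᵥ (d k *ᵥ p)) + star p ⬝ᵥ (z • r) := by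
      rw [hy', smul_add, dotProduct_add, dotProduct_smul, smul_eq_mul]
    rw [hpy]
    obtain ⟨hc2, hc3⟩ := Complex.nonneg_iff.mp hc1
    obtain ⟨hd2, hd3⟩ := Complex.nonneg_iff.mp hd1
    simp only [smul_eq_mul, Complex.add_re, Complex.mul_re, ← hc3, ← hd3, Complex.star_def,
      Complex.conj_re, mul_zero, sub_zero]
    have := mul_nonneg hz hc2
    have := mul_nonneg hz hd2
    linarith

lemma euclidPair_mulVec_eq_zero {z : ℂ} {v : Fin q → ℂ} (hh : h z *ᵥ v = 0)
    (hg : g z *ᵥ v = 0) (k : ℕ) :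
    (euclidPair c d h g k z).1 *ᵥ v = 0 ∧ (euclidPair c d h g k z).2 *ᵥ v = 0 := by
  induction k with
  | zero => exact ⟨hh, hg⟩
  | succ k ih =>
    have h1 : (euclidPair c d h g (k + 1) z).1 *ᵥ v = 0 := by
      rw [euclidPair, sub_mulVec, smul_mulVec, ← mulVec_mulVec, ih.1, ih.2]
      simp
    refine ⟨h1, ?_⟩
    have h2 := ih.2
    rwa [euclidPair_snd, add_mulVec, ← mulVec_mulVec, h1, mulVec_zero, zero_add] at h2

lemma fPoly_eq (m : ℕ) (A : ℕ → Mat q) (z : ℂ) :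
    fPoly q (2 * m) A z = hEven q m A (z ^ 2) + z • gEven q m A (z ^ 2) := by
  have key : ∀ (n : ℕ) (B : ℕ → Mat q), ∑ j ∈ Finset.range (2 * n + 1), B j =
      ∑ j ∈ Finset.range (n + 1), B (2 * j) + ∑ j ∈ Finset.range n, B (2 * j + 1) := by
    intro n B
    induction n with
    | zero => simp
    | succ n ih =>
      rw [show 2 * (n + 1) + 1 = 2 * n + 1 + 1 + 1 by ring, Finset.sum_range_succ,
        Finset.sum_range_succ, ih, Finset.sum_range_succ (fun j => B (2 * j)) (n + 1),
        Finset.sum_range_succ (fun j => B (2 * j + 1)) n,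
        mul_add_one 2 n]
      abel
  rw [fPoly, key, hEven, gEven, Finset.smul_sum]
  congr 1
  · refine Finset.sum_congr rfl fun j _ => ?_
    rw [← pow_mul, Nat.mul_sub]
  · refine Finset.sum_congr rfl fun j hj => ?_
    have := Finset.mem_range.mp hj
    rw [← pow_mul, smul_smul, ← pow_succ']
    congr 2
    omega

lemma tendsto_hEven (m : ℕ) (A : ℕ → Mat q) :
    Tendsto (fun n : ℕ => ((n : ℂ)⁻¹) ^ m • hEven q m A n) atTop (𝓝 (A 0)) := by
  have hinv : Tendsto (fun n : ℕ => (n : ℂ)⁻¹) atTop (𝓝 0) :=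
    tendsto_inv_atTop_nhds_zero_nat (𝕜 := ℂ)
  have hcont : Continuous fun s : ℂ => ∑ j ∈ Finset.range (m + 1), s ^ j • A (2 * j) := by
    fun_prop
  have h0 := (hcont.tendsto 0).comp hinv
  rw [Finset.sum_range_succ'] at h0
  simp only [pow_succ, mul_zero, zero_smul, Finset.sum_const_zero, pow_zero, one_smul,
    zero_add] at h0
  refine h0.congr' ?_
  filter_upwards [eventually_ne_atTop 0] with n hn
  have hn' : (n : ℂ) ≠ 0 := Nat.cast_ne_zero.mpr hn
  rw [Function.comp_apply, hEven, Finset.smul_sum]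
  refine Finset.sum_congr rfl fun j hj => ?_
  have hjm : j ≤ m := Nat.lt_succ_iff.mp (Finset.mem_range.mp hj)
  rw [smul_smul, ← Nat.sub_add_cancel hjm, Nat.add_sub_cancel, pow_add, mul_right_comm, ← mul_pow,
    inv_mul_cancel₀ hn', one_pow, one_mul]

end

theorem stmt_14 (q m : ℕ) (hq : 1 ≤ q) (hm : 1 ≤ m) (A : ℕ → Mat q)
    (hA0 : (A 0).det ≠ 0) (hC : CondC q (2 * m) A)
    (hHTM : IsHTMEven q m (hEven q m A) (gEven q m A)) :
    ∀ z : ℂ, (fPoly q (2 * m) A z).det = 0 → z.re < 0 := by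
  obtain ⟨c, d, hc, hd, hw⟩ := hHTM
  have hlim := tendsto_hEven m A
  have hh : IsPolyMat (hEven q m A) := .sum_pow_smul _ _ _
  have hg : IsPolyMat (gEven q m A) := .sum_pow_smul _ _ _
  have hlast : ∀ z, (euclidPair c d (hEven q m A) (gEven q m A) m z).2 = 0 := by
    refine (isPolyMat_euclidPair hh hg m).2.eq_zero_of_eventually ?_
    have hdet : Continuous fun M : Mat q => M.det := continuous_id.matrix_det
    filter_upwards [((hdet.tendsto _).comp hlim).eventually_ne hA0,
      Filter.eventually_gt_atTop 0] with n hn hpos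
    have ht : (0 : ℂ) < (n : ℂ) := by exact_mod_cast hpos
    have hn' : (hEven q m A n).det ≠ 0 := by
      rw [Function.comp_apply, det_smul] at hn
      exact right_ne_zero_of_mul hn
    have hwp := wEven_posDef hc hd ht
    have hwu : ∀ j < m, IsUnit (wEven q m c d j n).det := fun j hj =>
      (isUnit_iff_isUnit_det _).mp (hwp j hj).isUnit
    have heq := hw n hn' hwu fun j hj => (isUnit_iff_isUnit_det _).mp
      ((hd _ (by omega)).add (hwp j (by omega)).inv).isUnit
    refine euclidPair_snd_eq_zero hm hc hd ht ?_
    have hg' : gEven q m A n = (wEven q m c d (m - 1) n)⁻¹ * hEven q m A n := by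
      rw [← heq, nonsing_inv_mul_cancel_right _ _ hn'.isUnit]
    rw [hg', mul_nonsing_inv_cancel_left _ _ (hwu _ (by omega))]
  intro z hz
  by_contra! hre
  obtain ⟨v, hv, hfv⟩ := exists_mulVec_eq_zero_iff.mpr hz
  rw [fPoly_eq, add_mulVec, smul_mulVec] at hfv
  have hen := re_euclidPair_nonneg hc hd hlast hre v 0 (Nat.zero_le _)
  simp only [euclidPair] at hen
  rw [eq_neg_of_add_eq_zero_right hfv, dotProduct_neg, Complex.neg_re] at hen
  have hhv : hEven q m A (z ^ 2) *ᵥ v = 0 := by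
    by_contra hne
    have := (Complex.pos_iff.mp (dotProduct_star_self_pos_iff.mpr hne)).1
    linarith
  rw [hhv, zero_add] at hfv
  rcases smul_eq_zero.mp hfv with hz0 | hgv
  · refine hv (eq_zero_of_mulVec_eq_zero
      (det_euclidPair_ne_zero hc hd hh hg hlast hA0 hlim (z ^ 2)) ?_)
    rwa [hz0, zero_pow two_ne_zero, euclidPair_fst_zero, ← zero_pow two_ne_zero, ← hz0]
  · exact hv (eq_zero_of_mulVec_eq_zero (det_euclidPair_ne_zero hc hd hh hg hlast hA0 hlim (z ^ 2))
      (euclidPair_mulVec_eq_zero hhv hgv m).1)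

end
end

section
/- Let f be a Hurwitz-type matrix (HTM) polynomial of degree 2m+1 whose coefficients satisfy Condition C. Then f is a Hurwitz matrix polynomial: every root of the scalar polynomial det f(z) has negative real part. -/
open Matrix MeasureTheory
open scoped ComplexOrder

noncomputable section

open Polynomial Filter Topology

/-- The Euclidean-type recursion that strips the partial quotients `c 0, d 0, c 1, d 1, ...`
off a pair of matrix polynomials. -/
def stripPair {q : ℕ} (c d : ℕ → Mat q) (g h : (Mat q)[X]) : ℕ → (Mat q)[X] × (Mat q)[X]
  | 0 => (g, h)
  | k + 1 =>
    let N := (stripPair c d g h k).1 - C (c k) * (stripPair c d g h k).2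
    (N, (stripPair c d g h k).2 - C (d k) * N * X)

lemma stripPair_fst {q : ℕ} (c d : ℕ → Mat q) (g h : (Mat q)[X]) (k : ℕ) :
    (stripPair c d g h k).1 =
      C (c k) * (stripPair c d g h k).2 + (stripPair c d g h (k + 1)).1 := by
  simp [stripPair]

lemma stripPair_snd {q : ℕ} (c d : ℕ → Mat q) (g h : (Mat q)[X]) (k : ℕ) :
    (stripPair c d g h k).2 =
      C (d k) * (stripPair c d g h (k + 1)).1 * X + (stripPair c d g h (k + 1)).2 := by
  simp [stripPair]

lemma eval_stripPair_fst {q : ℕ} (c d : ℕ → Mat q) (g h : (Mat q)[X]) (k : ℕ) (z : ℂ) :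
    (stripPair c d g h k).1.eval (z • 1) =
      c k * (stripPair c d g h k).2.eval (z • 1) +
        (stripPair c d g h (k + 1)).1.eval (z • 1) := by
  conv_lhs => rw [stripPair_fst]
  rw [eval_add, eval_C_mul]

lemma eval_stripPair_snd {q : ℕ} (c d : ℕ → Mat q) (g h : (Mat q)[X]) (k : ℕ) (z : ℂ) :
    (stripPair c d g h k).2.eval (z • 1) =
      z • (d k * (stripPair c d g h (k + 1)).1.eval (z • 1)) +
        (stripPair c d g h (k + 1)).2.eval (z • 1) := by
  conv_lhs => rw [stripPair_snd]
  rw [eval_add, eval_mul_X, eval_C_mul, mul_smul_comm, mul_one]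

/-- A matrix polynomial vanishing at infinitely many scalars is zero. -/
lemma eq_zero_of_infinite_eval_smul_one {q : ℕ} (Q : (Mat q)[X])
    (hQ : {z : ℂ | Q.eval (z • 1) = 0}.Infinite) : Q = 0 := by
  obtain ⟨M, rfl⟩ := matPolyEquiv.surjective Q
  have hM : M = 0 := by
    ext1 i j
    refine Polynomial.eq_zero_of_infinite_isRoot _ (hQ.mono fun z hz => ?_)
    have h := congrFun (congrFun hz i) j
    rwa [Matrix.smul_one_eq_diagonal, ← Matrix.scalar_apply, matPolyEquiv_eval] at h
  rw [hM, map_zero]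

/-- The dissipation argument: a passive ladder recursion with `Re u ≥ 0` whose input satisfies
`e 0 + n 0 = 0` vanishes identically. -/
lemma ladder_eq_zero {q m : ℕ} {c d : ℕ → Mat q} (hc : ∀ k ≤ m, (c k).PosDef)
    (hd : ∀ k < m, (d k).PosDef) {u : ℂ} (hu : 0 ≤ u.re) (n e : ℕ → Fin q → ℂ)
    (hn : ∀ k < m, n k = u • (c k *ᵥ e k) + n (k + 1))
    (he : ∀ k < m, e k = u • (d k *ᵥ n (k + 1)) + e (k + 1))
    (hlast : n m = u • (c m *ᵥ e m)) (h0 : e 0 + n 0 = 0) : e m = 0 := by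
  have hform : ∀ (M : Mat q), M.PosDef → ∀ x : Fin q → ℂ, ∀ v : ℂ, 0 ≤ v.re →
      0 ≤ (v * (star x ⬝ᵥ (M *ᵥ x))).re := by
    intro M hM x v hv
    have h := Complex.nonneg_iff.mp (hM.posSemidef.dotProduct_mulVec_nonneg x)
    rw [Complex.mul_re, ← h.2, mul_zero, sub_zero]
    exact mul_nonneg hv h.1
  have key : ∀ j ≤ m, 0 ≤ (star (e (m - j)) ⬝ᵥ n (m - j)).re := by
    intro j
    induction j with
    | zero =>
      intro _
      rw [Nat.sub_zero, hlast, dotProduct_smul, smul_eq_mul]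
      exact hform _ (hc m le_rfl) _ _ hu
    | succ j ih =>
      intro hj
      have hk : m - (j + 1) < m := by omega
      have hk1 : m - (j + 1) + 1 = m - j := by omega
      have hi := ih (by omega)
      rw [hn _ hk, dotProduct_add, dotProduct_smul, smul_eq_mul, Complex.add_re]
      refine add_nonneg (hform _ (hc _ hk.le) _ _ hu) ?_
      rw [he _ hk, hk1, star_add, star_smul, add_dotProduct, smul_dotProduct, smul_eq_mul,
        star_mulVec, ← dotProduct_mulVec, (hd _ hk).isHermitian.eq, Complex.add_re]
      exact add_nonneg (hform _ (hd _ hk) _ _ (by simpa using hu)) hi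
  have hn0 : n 0 = - e 0 := (neg_eq_of_add_eq_zero_right h0).symm
  have he0 : e 0 = 0 := by
    have h := key m le_rfl
    rw [Nat.sub_self, hn0, dotProduct_neg, Complex.neg_re] at h
    have h2 := Complex.nonneg_iff.mp (dotProduct_star_self_nonneg (e 0))
    refine dotProduct_star_self_eq_zero.mp (Complex.ext ?_ h2.2.symm)
    rw [Complex.zero_re]
    linarith [h2.1]
  have hall : ∀ k ≤ m, e k = 0 ∧ n k = 0 := by
    intro k
    induction k with
    | zero => intro _; exact ⟨he0, by rw [hn0, he0, neg_zero]⟩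
    | succ k ih =>
      intro hk
      obtain ⟨h1, h2⟩ := ih (by omega)
      have h3 := hn k (by omega)
      rw [h1, h2, mulVec_zero, smul_zero, zero_add] at h3
      have h4 := he k (by omega)
      rw [h1, ← h3, mulVec_zero, smul_zero, zero_add] at h4
      exact ⟨h4.symm, h3.symm⟩
  exact (hall m le_rfl).1

/-- Undoing `j` steps of the recursion raises the degree by exactly `j`, with an invertible
factor in the leading coefficient. -/
lemma stripPair_degree {q m : ℕ} {c d : ℕ → Mat q} (g h : (Mat q)[X])
    (hc : ∀ k ≤ m, (c k).PosDef) (hd : ∀ k < m, (d k).PosDef)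
    (hlast : (stripPair c d g h m).1 = C (c m) * (stripPair c d g h m).2) (p : ℕ)
    (hp : (stripPair c d g h m).2.natDegree ≤ p) :
    ∀ j ≤ m, (∀ n, j + p < n → (stripPair c d g h (m - j)).1.coeff n = 0 ∧
        (stripPair c d g h (m - j)).2.coeff n = 0) ∧
      ∃ K : Mat q, IsUnit K ∧ (stripPair c d g h (m - j)).1.coeff (j + p) =
        K * (stripPair c d g h m).2.coeff p := by
  intro j
  induction j with
  | zero =>
    intro _
    refine ⟨fun n hn => ?_, c m, (hc m le_rfl).isUnit, ?_⟩
    · have h0 : (stripPair c d g h m).2.coeff n = 0 := coeff_eq_zero_of_natDegree_lt (by omega)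
      rw [Nat.sub_zero, hlast, coeff_C_mul, h0, mul_zero]
      exact ⟨rfl, rfl⟩
    · rw [Nat.sub_zero, hlast, coeff_C_mul, zero_add]
  | succ j ih =>
    intro hj
    obtain ⟨hz, K, hK, hcoeff⟩ := ih (by omega)
    have hk : m - (j + 1) < m := by omega
    have hk1 : m - (j + 1) + 1 = m - j := by omega
    have h2 : ∀ n, (stripPair c d g h (m - (j + 1))).2.coeff (n + 1) =
        d (m - (j + 1)) * (stripPair c d g h (m - j)).1.coeff n +
          (stripPair c d g h (m - j)).2.coeff (n + 1) := by
      intro n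
      rw [stripPair_snd, hk1, coeff_add, coeff_mul_X, coeff_C_mul]
    have h1 : ∀ n, (stripPair c d g h (m - (j + 1))).1.coeff n =
        c (m - (j + 1)) * (stripPair c d g h (m - (j + 1))).2.coeff n +
          (stripPair c d g h (m - j)).1.coeff n := by
      intro n
      conv_lhs => rw [stripPair_fst, hk1, coeff_add, coeff_C_mul]
    refine ⟨fun n hn => ?_, c (m - (j + 1)) * (d (m - (j + 1)) * K), ?_, ?_⟩
    · obtain ⟨n, rfl⟩ : ∃ n', n = n' + 1 := ⟨n - 1, by omega⟩
      have h3 : (stripPair c d g h (m - (j + 1))).2.coeff (n + 1) = 0 := by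
        rw [h2, (hz n (by omega)).1, (hz (n + 1) (by omega)).2, mul_zero, add_zero]
      exact ⟨by rw [h1, h3, (hz (n + 1) (by omega)).1, mul_zero, add_zero], h3⟩
    · exact (hc _ hk.le).isUnit.mul ((hd _ hk).isUnit.mul hK)
    · rw [show j + 1 + p = j + p + 1 by omega, h1, h2, (hz (j + p + 1) (by omega)).1,
        (hz (j + p + 1) (by omega)).2, hcoeff]
      simp only [add_zero, mul_assoc]

lemma wOdd_posDef {q m : ℕ} (hm : 1 ≤ m) {c d : ℕ → Mat q} (hc : ∀ k ≤ m, (c k).PosDef)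
    (hd : ∀ k < m, (d k).PosDef) {z : ℂ} (hz : 0 < z) : ∀ j < m, (wOdd q m c d j z).PosDef := by
  intro j
  induction j with
  | zero =>
    intro _
    exact ((hc _ (by omega)).smul hz).add
      ((hd _ (by omega)).add ((hc m le_rfl).inv.smul (inv_pos.mpr hz))).inv
  | succ j ih =>
    intro hj
    exact ((hc _ (by omega)).smul hz).add ((hd _ (by omega)).add (ih (by omega)).inv).inv

/-- If `(z c + S⁻¹) D = z N`, the stripped pair `(N - c D, D - z d (N - c D))` satisfies the
same relation with `S - d` in place of the inverse. -/
lemma strip_relation {q : ℕ} {c S N D N' : Mat q} {z : ℂ} (hS : IsUnit S.det)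
    (h : (z • c + S⁻¹) * D = z • N) (hN : N = c * D + N') : D = z • (S * N') := by
  have h1 : S⁻¹ * D = z • N' := by
    rw [add_mul, hN, smul_add, smul_mul_assoc] at h
    exact add_left_cancel h
  rw [← mul_smul_comm, ← h1, mul_nonsing_inv_cancel_left _ _ hS]

/-- At every positive point, the continued fraction identity forces the recursion to end in
a pair `(c m * P, P)`. -/
lemma stripPair_last_eval {q m : ℕ} (hm : 1 ≤ m) {c d : ℕ → Mat q} (g h : (Mat q)[X])
    (hc : ∀ k ≤ m, (c k).PosDef) (hd : ∀ k < m, (d k).PosDef) {z : ℂ} (hz : 0 < z)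
    (h0 : wOdd q m c d (m - 1) z * h.eval (z • 1) = z • g.eval (z • 1)) :
    (stripPair c d g h m).1.eval (z • 1) = c m * (stripPair c d g h m).2.eval (z • 1) := by
  have hw := wOdd_posDef hm hc hd hz
  have key : ∀ k < m, wOdd q m c d (m - 1 - k) z * (stripPair c d g h k).2.eval (z • 1) =
      z • (stripPair c d g h k).1.eval (z • 1) := by
    intro k
    induction k with
    | zero => intro _; exact h0
    | succ k ih =>
      intro hk
      have hi := ih (by omega)
      rw [show m - 1 - k = (m - 1 - (k + 1)) + 1 by omega, wOdd,
        show m - 2 - (m - 1 - (k + 1)) = k by omega] at hi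
      have hwj := hw (m - 1 - (k + 1)) (by omega)
      have hS := (hd k (by omega)).add hwj.inv
      have h1 := strip_relation ((isUnit_iff_isUnit_det _).mp hS.isUnit) hi
        (eval_stripPair_fst c d g h k z)
      rw [eval_stripPair_snd, add_mul, smul_add] at h1
      rw [add_left_cancel h1, mul_smul_comm,
        mul_nonsing_inv_cancel_left _ _ ((isUnit_iff_isUnit_det _).mp hwj.isUnit)]
  have hl := key (m - 1) (by omega)
  rw [show m - 1 - (m - 1) = 0 by omega, wOdd] at hl
  have hcm := hc m le_rfl
  have hS := (hd (m - 1) (by omega)).add (hcm.inv.smul (inv_pos.mpr hz))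
  have h1 := strip_relation ((isUnit_iff_isUnit_det _).mp hS.isUnit) hl
    (eval_stripPair_fst c d g h (m - 1) z)
  rw [eval_stripPair_snd, add_mul, smul_add, show m - 1 + 1 = m by omega] at h1
  rw [add_left_cancel h1, smul_mul_assoc, smul_smul, mul_inv_cancel₀ hz.ne', one_smul,
    mul_nonsing_inv_cancel_left _ _ ((isUnit_iff_isUnit_det _).mp hcm.isUnit)]

/-- A matrix polynomial function with invertible leading coefficient is invertible at all
sufficiently large positive reals. -/
lemma eventually_det_ne_zero {q : ℕ} (m : ℕ) (B : ℕ → Mat q) (hB : (B 0).det ≠ 0) :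
    ∀ᶠ x : ℝ in atTop,
      (∑ j ∈ Finset.range (m + 1), ((x : ℂ) ^ (m - j)) • B j).det ≠ 0 := by
  have hcont : Continuous fun t : ℝ =>
      (∑ j ∈ Finset.range (m + 1), ((t : ℂ) ^ j) • B j).det := by fun_prop
  have hzero : (∑ j ∈ Finset.range (m + 1), (((0 : ℝ) : ℂ) ^ j) • B j).det ≠ 0 := by
    rw [Finset.sum_range_succ']
    simpa using hB
  have h1 := tendsto_inv_atTop_zero.eventually (hcont.continuousAt.eventually_ne hzero)
  filter_upwards [h1, eventually_gt_atTop 0] with x hx hx0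
  have hxc : (x : ℂ) ≠ 0 := by exact_mod_cast hx0.ne'
  have hsum : ∑ j ∈ Finset.range (m + 1), ((x : ℂ) ^ (m - j)) • B j =
      ((x : ℂ) ^ m) • ∑ j ∈ Finset.range (m + 1), (((x⁻¹ : ℝ) : ℂ) ^ j) • B j := by
    rw [Finset.smul_sum]
    refine Finset.sum_congr rfl fun j hj => ?_
    rw [smul_smul, pow_sub₀ _ hxc (by simpa [Nat.lt_succ_iff] using hj), Complex.ofReal_inv,
      inv_pow]
  rw [hsum, det_smul]
  exact mul_ne_zero (pow_ne_zero _ (pow_ne_zero _ hxc)) hx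

/-- The matrix polynomial `B 0 * X^m + B 1 * X^(m-1) + ... + B m`. -/
def descPoly {q : ℕ} (m : ℕ) (B : ℕ → Mat q) : (Mat q)[X] :=
  ∑ j ∈ Finset.range (m + 1), monomial (m - j) (B j)

lemma eval_descPoly {q : ℕ} (m : ℕ) (B : ℕ → Mat q) (z : ℂ) :
    (descPoly m B).eval (z • 1) = ∑ j ∈ Finset.range (m + 1), z ^ (m - j) • B j := by
  simp [descPoly, eval_finsetSum, eval_monomial, _root_.smul_pow]

lemma coeff_descPoly_self {q : ℕ} (m : ℕ) (B : ℕ → Mat q) : (descPoly m B).coeff m = B 0 := by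
  rw [descPoly, finsetSum_coeff, Finset.sum_eq_single 0]
  · simp
  · intro j hj hj0
    rw [coeff_monomial, if_neg]
    have := Finset.mem_range.mp hj
    omega
  · simp

lemma coeff_descPoly_of_lt {q : ℕ} {m n : ℕ} (B : ℕ → Mat q) (h : m < n) :
    (descPoly m B).coeff n = 0 := by
  rw [descPoly, finsetSum_coeff]
  refine Finset.sum_eq_zero fun j _ => ?_
  rw [coeff_monomial, if_neg (by omega)]

lemma sum_range_even_add_odd {M : Type*} [AddCommMonoid M] (n : ℕ) (F : ℕ → M) :
    ∑ j ∈ Finset.range (2 * n), F j =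
      ∑ j ∈ Finset.range n, F (2 * j + 1) + ∑ j ∈ Finset.range n, F (2 * j) := by
  induction n with
  | zero => simp
  | succ n ih =>
    rw [show 2 * (n + 1) = 2 * n + 1 + 1 by ring, Finset.sum_range_succ, Finset.sum_range_succ,
      ih, Finset.sum_range_succ, Finset.sum_range_succ]
    abel

lemma fPoly_odd_eq {q m : ℕ} (A : ℕ → Mat q) (u : ℂ) :
    fPoly q (2 * m + 1) A u = hOdd q m A (u ^ 2) + u • gOdd q m A (u ^ 2) := by
  rw [fPoly, show 2 * m + 1 + 1 = 2 * (m + 1) by ring, sum_range_even_add_odd, hOdd, gOdd,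
    Finset.smul_sum]
  congr 1
  · refine Finset.sum_congr rfl fun j _ => ?_
    rw [← pow_mul]
    congr 2
    omega
  · refine Finset.sum_congr rfl fun j hj => ?_
    have := Finset.mem_range.mp hj
    rw [← pow_mul, smul_smul, ← pow_succ']
    congr 2
    omega

theorem stmt_15 (q m : ℕ) (hq : 1 ≤ q) (hm : 1 ≤ m) (A : ℕ → Mat q)
    (hA0 : (A 0).det ≠ 0) (hC : CondC q (2 * m + 1) A)
    (hHTM : IsHTMOdd q m (hOdd q m A) (gOdd q m A)) :
    ∀ z : ℂ, (fPoly q (2 * m + 1) A z).det = 0 → z.re < 0 := by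
  obtain ⟨c, d, hc, hd, hid⟩ := hHTM
  set g : (Mat q)[X] := descPoly m fun j => A (2 * j)
  set h : (Mat q)[X] := descPoly m fun j => A (2 * j + 1)
  have hg_eval : ∀ z : ℂ, g.eval (z • 1) = gOdd q m A z := eval_descPoly m _
  have hh_eval : ∀ z : ℂ, h.eval (z • 1) = hOdd q m A z := eval_descPoly m _
  have hlast : (stripPair c d g h m).1 = C (c m) * (stripPair c d g h m).2 := by
    have hev : ∀ᶠ x : ℝ in atTop, ((stripPair c d g h m).1 -
        C (c m) * (stripPair c d g h m).2).eval ((x : ℂ) • 1) = 0 := by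
      filter_upwards [eventually_det_ne_zero m (fun j => A (2 * j)) hA0,
        eventually_gt_atTop 0] with x hx hx0
      have hxc : (0 : ℂ) < x := by exact_mod_cast hx0
      have hw := wOdd_posDef hm hc hd hxc
      have hunit : IsUnit ((x : ℂ) • gOdd q m A x).det := by
        rw [det_smul]
        exact (mul_ne_zero (pow_ne_zero _ hxc.ne') hx).isUnit
      have hx1 := hid x hxc.ne' hx
        ((isUnit_iff_isUnit_det _).mp ((hd (m - 1) (by omega)).add
          ((hc m le_rfl).inv.smul (inv_pos.mpr hxc))).isUnit)
        (fun j hj => (isUnit_iff_isUnit_det _).mp (hw j hj).isUnit)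
        (fun j hj => (isUnit_iff_isUnit_det _).mp
          ((hd _ (by omega)).add (hw j (by omega)).inv).isUnit)
      rw [eval_sub, eval_C_mul, sub_eq_zero]
      refine stripPair_last_eval hm g h hc hd hxc ?_
      have hx2 := congrArg (· * ((x : ℂ) • gOdd q m A x)) hx1
      simp only [nonsing_inv_mul_cancel_right _ _ hunit] at hx2
      rw [hg_eval, hh_eval, hx2, mul_nonsing_inv_cancel_left _ _
        ((isUnit_iff_isUnit_det _).mp (hw (m - 1) (by omega)).isUnit)]
    obtain ⟨a, ha⟩ := eventually_atTop.mp hev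
    refine sub_eq_zero.mp (eq_zero_of_infinite_eval_smul_one _ ?_)
    refine ((Set.Ici_infinite a).image Complex.ofReal_injective.injOn).mono ?_
    rintro _ ⟨x, hx, rfl⟩
    exact ha x hx
  obtain ⟨L, hL, hP⟩ : ∃ L : Mat q, IsUnit L ∧ (stripPair c d g h m).2 = C L := by
    obtain ⟨-, K, hK, hcoeff⟩ := stripPair_degree g h hc hd hlast _ le_rfl m le_rfl
    rw [Nat.sub_self] at hcoeff
    change g.coeff _ = _ at hcoeff
    have hdeg : (stripPair c d g h m).2.natDegree = 0 := by
      by_contra hne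
      rw [coeff_descPoly_of_lt _ (by omega)] at hcoeff
      have h0 := (hK.mul_right_eq_zero).mp hcoeff.symm
      rw [coeff_natDegree, leadingCoeff_eq_zero] at h0
      exact hne (by rw [h0, natDegree_zero])
    rw [hdeg, add_zero, coeff_descPoly_self] at hcoeff
    refine ⟨_, ?_, eq_C_of_natDegree_eq_zero hdeg⟩
    rw [isUnit_iff_isUnit_det, isUnit_iff_ne_zero]
    intro h0
    apply hA0
    change (A (2 * 0)).det = 0
    rw [hcoeff, det_mul, h0, mul_zero]
  intro u hu
  by_contra! hre
  obtain ⟨x, hx0, hx⟩ := exists_mulVec_eq_zero_iff.mpr hu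
  have hem := ladder_eq_zero hc hd hre
    (fun k => u • ((stripPair c d g h k).1.eval ((u ^ 2) • 1) *ᵥ x))
    (fun k => (stripPair c d g h k).2.eval ((u ^ 2) • 1) *ᵥ x)
    (fun k _ => by
      rw [eval_stripPair_fst, add_mulVec, smul_add, mulVec_mulVec])
    (fun k _ => by
      rw [eval_stripPair_snd, add_mulVec, smul_mulVec, mulVec_smul, mulVec_mulVec, smul_smul,
        ← sq])
    (by simp only [hlast, eval_C_mul, mulVec_mulVec])
    (by
      change h.eval _ *ᵥ x + u • (g.eval _ *ᵥ x) = 0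
      rw [hg_eval, hh_eval, ← smul_mulVec, ← add_mulVec, ← fPoly_odd_eq, hx])
  rw [hP, eval_C] at hem
  exact hx0 (mulVec_injective_of_isUnit hL (by rw [hem, mulVec_zero]))

end
end

section
/- Let s_0 and s_1 be Hermitian positive definite q×q complex matrices. Then every root of the scalar polynomial det( z² I_q + s_0 z + s_0^{-1} s_1 ) has negative real part; that is, the matrix polynomial f(z) = I_q z² + s_0 z + s_0^{-1} s_1 is a Hurwitz matrix polynomial. -/
open Matrix MeasureTheory
open scoped ComplexOrder

noncomputable section

theorem re_neg_of_quadratic_eq_zero {a b c : ℝ} (ha : 0 < a) (hb : 0 < b) (hc : 0 < c) {z : ℂ}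
    (h : z ^ 2 * a + z * b + c = 0) : z.re < 0 := by
  have hre := congrArg Complex.re h
  have him := congrArg Complex.im h
  simp [pow_two] at hre him
  by_contra! hz
  have him' : z.im * (2 * a * z.re + b) = 0 := by linarith
  have hpos : 0 < 2 * a * z.re + b := by positivity
  have hz0 : z.im = 0 := (mul_eq_zero.mp him').resolve_right hpos.ne'
  rw [hz0] at hre
  have : 0 < z.re * z.re * a + z.re * b + c := by positivity
  linarith

theorem Matrix.PosDef.exists_real_dotProduct_mulVec {n : Type*} [Fintype n] {M : Matrix n n ℂ}
    (hM : M.PosDef) {v : n → ℂ} (hv : v ≠ 0) : ∃ r : ℝ, 0 < r ∧ star v ⬝ᵥ (M *ᵥ v) = r := by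
  obtain ⟨hre, him⟩ := Complex.pos_iff.mp (hM.dotProduct_mulVec_pos hv)
  exact ⟨_, hre, Complex.ext rfl him.symm⟩

theorem Matrix.PosDef.re_neg_of_det_quadratic_eq_zero {n : Type*} [Fintype n] [DecidableEq n]
    {A B C : Matrix n n ℂ} (hA : A.PosDef) (hB : B.PosDef) (hC : C.PosDef) {z : ℂ}
    (h : (z ^ 2 • A + z • B + C).det = 0) : z.re < 0 := by
  obtain ⟨v, hv, hv0⟩ := Matrix.exists_mulVec_eq_zero_iff.mpr h
  obtain ⟨a, ha, hav⟩ := hA.exists_real_dotProduct_mulVec hv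
  obtain ⟨b, hb, hbv⟩ := hB.exists_real_dotProduct_mulVec hv
  obtain ⟨c, hc, hcv⟩ := hC.exists_real_dotProduct_mulVec hv
  refine re_neg_of_quadratic_eq_zero ha hb hc ?_
  have := congrArg (star v ⬝ᵥ ·) hv0
  simpa [Matrix.add_mulVec, Matrix.smul_mulVec, dotProduct_add, hav, hbv, hcv] using this

theorem stmt_16 (q : ℕ) (hq : 1 ≤ q) (s0 s1 : Mat q)
    (hs0 : s0.PosDef) (hs1 : s1.PosDef) :
    ∀ z : ℂ, (z ^ 2 • (1 : Mat q) + z • s0 + s0⁻¹ * s1).det = 0 → z.re < 0 := by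
  intro z hz
  have hu : IsUnit s0.det := s0.isUnit_iff_isUnit_det.mp hs0.isUnit
  have hsq : (s0 * s0).PosDef := by
    simpa [hs0.isHermitian.eq] using
      Matrix.PosDef.conjTranspose_mul_self s0 (Matrix.mulVec_injective_of_isUnit hs0.isUnit)
  refine hs0.re_neg_of_det_quadratic_eq_zero hsq hs1 (z := z) ?_
  have hfactor : z ^ 2 • s0 + z • (s0 * s0) + s1
      = s0 * (z ^ 2 • (1 : Mat q) + z • s0 + s0⁻¹ * s1) := by
    simp [mul_add, Matrix.mul_nonsing_inv_cancel_left _ _ hu]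
  rw [hfactor, Matrix.det_mul, hz, mul_zero]

end
end

section
/- Let f be a Hurwitz-type matrix (HTM) polynomial of degree 2m with h-part h and g-part g. Then: (a) there is a unique block matrix Γ = (Γ_{jk})_{j,k=0}^{m-1} ∈ ℂ^{mq×mq} such that λ·g^♯(λ)·h(μ) − h^♯(λ)·μ·g(μ) = (λ−μ)·Σ_{j,k=0}^{m-1} λ^j Γ_{jk} μ^k for all λ, μ ∈ ℂ (the Bezoutian associated with the quadruple (λg^♯, h, h^♯, λg)), and this Γ is Hermitian positive definite; (b) there is a unique block matrix Γ' = (Γ'_{jk})_{j,k=0}^{m-1} ∈ ℂ^{mq×mq} such that g^♯(λ)·h(μ) − h^♯(λ)·g(μ) = (λ−μ)·Σ_{j,k=0}^{m-1} λ^j Γ'_{jk} μ^k for all λ, μ ∈ ℂ (the Bezoutian associated with (g^♯, h, h^♯, g)), and this Γ' is Hermitian negative definite. -/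
open Matrix MeasureTheory
open scoped ComplexOrder

noncomputable section

open Polynomial in
/-- Evaluation of a matrix polynomial at a complex scalar. -/
def evalScalar {q : ℕ} (z : ℂ) (p : (Mat q)[X]) : Mat q :=
  p.eval (algebraMap ℂ (Mat q) z)

section EvalScalar

open Polynomial

variable {q : ℕ} (z : ℂ) (p r : (Mat q)[X]) (M : Mat q)

lemma evalScalar_add : evalScalar z (p + r) = evalScalar z p + evalScalar z r := eval_add

lemma evalScalar_sub : evalScalar z (p - r) = evalScalar z p - evalScalar z r :=
  eval_sub (R := Mat q) ..

lemma evalScalar_C_mul : evalScalar z (C M * p) = M * evalScalar z p := eval_C_mul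

lemma evalScalar_mul_X : evalScalar z (p * X) = z • evalScalar z p := by
  rw [evalScalar, eval_mul_X, ← Algebra.commutes, ← Algebra.smul_def, evalScalar]

lemma evalScalar_monomial (n : ℕ) : evalScalar z (monomial n M) = z ^ n • M := by
  rw [evalScalar, eval_monomial, ← map_pow, ← Algebra.commutes, ← Algebra.smul_def]

lemma evalScalar_finsetSum {ι : Type*} (s : Finset ι) (f : ι → (Mat q)[X]) :
    evalScalar z (∑ i ∈ s, f i) = ∑ i ∈ s, evalScalar z (f i) := eval_finsetSum ..

lemma evalScalar_eq_sum {n : ℕ} (hp : ∀ j, n ≤ j → p.coeff j = 0) :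
    evalScalar z p = ∑ j ∈ Finset.range n, z ^ j • p.coeff j := by
  have : p = ∑ j ∈ Finset.range n, monomial j (p.coeff j) := by
    ext1 j
    simp only [finsetSum_coeff, coeff_monomial, Finset.sum_ite_eq', Finset.mem_range]
    split_ifs with h
    · rfl
    · exact hp j (not_lt.1 h)
  conv_lhs => rw [this]
  simp only [evalScalar_finsetSum, evalScalar_monomial]

end EvalScalar

/-- A finite power sum vanishing at infinitely many points has zero coefficients. -/
lemma coeff_eq_zero_of_infinite_zeros (n : ℕ) (a : ℕ → ℂ) (s : Set ℂ) (hs : s.Infinite)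
    (h : ∀ z ∈ s, ∑ j ∈ Finset.range n, z ^ j * a j = 0) (j : ℕ) (hj : j < n) : a j = 0 := by
  have h0 : (∑ j ∈ Finset.range n, Polynomial.monomial j (a j)) = 0 := by
    refine Polynomial.eq_zero_of_infinite_isRoot _ (hs.mono fun z hz => ?_)
    simp only [Set.mem_ofPred_eq, Polynomial.IsRoot.def, Polynomial.eval_finsetSum,
      Polynomial.eval_monomial]
    rw [← h z hz]
    exact Finset.sum_congr rfl fun _ _ => mul_comm _ _
  have h1 := congrArg (fun p => Polynomial.coeff p j) h0
  simpa [Polynomial.finsetSum_coeff, Polynomial.coeff_monomial, hj] using h1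

lemma infinite_ofReal_Ioi (M : ℝ) : (Complex.ofReal '' Set.Ioi M).Infinite :=
  (Set.Ioi_infinite M).image Complex.ofReal_injective.injOn

open Polynomial in
lemma eq_zero_of_evalScalar_eq_zero {q : ℕ} (p : (Mat q)[X]) (s : Set ℂ) (hs : s.Infinite)
    (h : ∀ z ∈ s, evalScalar z p = 0) : p = 0 := by
  have hp : ∀ j, p.natDegree + 1 ≤ j → p.coeff j = 0 := fun j hj =>
    coeff_eq_zero_of_natDegree_lt hj
  ext j a b
  by_cases hj : j < p.natDegree + 1
  · refine coeff_eq_zero_of_infinite_zeros (p.natDegree + 1) (fun j => p.coeff j a b) s hs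
      (fun z hz => ?_) j hj
    have h1 := congrArg (fun N : Mat q => N a b) ((evalScalar_eq_sum z p hp).symm.trans (h z hz))
    simpa [Matrix.sum_apply] using h1
  · rw [hp j (not_lt.1 hj)]; simp

/-- The matrix continued fraction `V_{n+1}(z) = (z c_n + (d_n + V_n(z))⁻¹)⁻¹` with `V_0 = 0`. -/
def contFrac {q : ℕ} (c d : ℕ → Mat q) : ℕ → ℂ → Mat q
  | 0, _ => 0
  | n + 1, z => (z • c n + (d n + contFrac c d n z)⁻¹)⁻¹

lemma inv_wEven_eq_contFrac {q : ℕ} (m : ℕ) (c d : ℕ → Mat q) (j : ℕ) (z : ℂ) :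
    (wEven q m c d j z)⁻¹ =
      contFrac (fun n => c (m - 1 - n)) (fun n => d (m - 1 - n)) (j + 1) z := by
  induction j with
  | zero => simp [wEven, contFrac]
  | succ j ih =>
    have e : m - 2 - j = m - 1 - (j + 1) := by omega
    rw [contFrac, ← ih, wEven, e]

lemma contFrac_posSemidef {q : ℕ} {c d : ℕ → Mat q} {n : ℕ} (hc : ∀ k < n, (c k).PosDef)
    (hd : ∀ k < n, (d k).PosDef) {x : ℝ} (hx : 0 < x) : (contFrac c d n x).PosSemidef := by
  induction n with
  | zero => exact PosSemidef.zero
  | succ n ih =>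
    have ih' := ih (fun k hk => hc k (hk.trans n.lt_succ_self))
      (fun k hk => hd k (hk.trans n.lt_succ_self))
    exact (((hc n n.lt_succ_self).smul (Complex.zero_lt_real.2 hx)).add
      ((hd n n.lt_succ_self).add_posSemidef ih').inv).inv.posSemidef

section Euclid

open Polynomial

/-- Unwinding the continued fraction by the Euclidean algorithm. -/
lemma exists_euclid_seq {q : ℕ} {c d : ℕ → Mat q} (n : ℕ) (hc : ∀ k < n, (c k).PosDef)
    (hd : ∀ k < n, (d k).PosDef) {M : ℝ} (hM : 0 ≤ M) (P Q : (Mat q)[X])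
    (h : ∀ x : ℝ, M < x → evalScalar x Q = contFrac c d n x * evalScalar x P) :
    ∃ p r : ℕ → (Mat q)[X], p n = P ∧ r n = Q ∧ r 0 = 0 ∧
      (∀ k < n, r (k + 1) = C (d k) * p k + r k) ∧
      (∀ k < n, p (k + 1) = C (c k) * r (k + 1) * X + p k) := by
  induction n generalizing P Q with
  | zero =>
    refine ⟨fun _ => P, fun _ => Q, rfl, rfl, ?_, by simp, by simp⟩
    refine eq_zero_of_evalScalar_eq_zero Q _ (infinite_ofReal_Ioi M) ?_
    rintro _ ⟨x, hx, rfl⟩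
    simpa [contFrac] using h x hx
  | succ n ih =>
    have hc' : ∀ k < n, (c k).PosDef := fun k hk => hc k (hk.trans n.lt_succ_self)
    have hd' : ∀ k < n, (d k).PosDef := fun k hk => hd k (hk.trans n.lt_succ_self)
    set P' := P - C (c n) * Q * X with hP'
    set Q' := Q - C (d n) * P' with hQ'
    obtain ⟨p, r, hp, hr, hr0, hrk, hpk⟩ := ih hc' hd' P' Q' (fun x hx => by
      have hx0 : 0 < x := hM.trans_lt hx
      have hV := (hd n n.lt_succ_self).add_posSemidef (contFrac_posSemidef hc' hd' hx0)
      have hW := ((hc n n.lt_succ_self).smul (Complex.zero_lt_real.2 hx0)).add hV.inv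
      have hVu := (Matrix.isUnit_iff_isUnit_det _).1 hV.isUnit
      have hWu := (Matrix.isUnit_iff_isUnit_det _).1 hW.isUnit
      have h1 := h x hx
      rw [contFrac] at h1
      have h2 : evalScalar x P = ((x : ℂ) • c n + (d n + contFrac c d n x)⁻¹) * evalScalar x Q := by
        rw [h1, Matrix.mul_nonsing_inv_cancel_left _ _ hWu]
      have h3 : evalScalar x P' = (d n + contFrac c d n x)⁻¹ * evalScalar x Q := by
        rw [hP', evalScalar_sub, evalScalar_mul_X, evalScalar_C_mul, h2, add_mul, smul_mul_assoc,
          add_sub_cancel_left]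
      have h4 : evalScalar x Q = (d n + contFrac c d n x) * evalScalar x P' := by
        rw [h3, Matrix.mul_nonsing_inv_cancel_left _ _ hVu]
      rw [hQ', evalScalar_sub, evalScalar_C_mul, h4, add_mul, add_sub_cancel_left])
    refine ⟨fun k => if k ≤ n then p k else P, fun k => if k ≤ n then r k else Q,
      by simp, by simp, by simpa using hr0, ?_, ?_⟩
    · intro k hk
      rcases (Nat.lt_succ_iff_lt_or_eq.1 hk) with hk | rfl
      · simpa [hk.le, Nat.succ_le_of_lt hk] using hrk k hk
      · simp [hp, hr, hQ']
    · intro k hk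
      rcases (Nat.lt_succ_iff_lt_or_eq.1 hk) with hk | rfl
      · simpa [hk.le, Nat.succ_le_of_lt hk] using hpk k hk
      · simp [hp, hP']

/-- Degrees and leading coefficients along the Euclidean recursion. -/
lemma euclid_seq_coeff {q : ℕ} {c d : ℕ → Mat q} {n : ℕ} (hc : ∀ k < n, IsUnit (c k))
    (hd : ∀ k < n, IsUnit (d k)) {p r : ℕ → (Mat q)[X]} (hr0 : r 0 = 0)
    (hr : ∀ k < n, r (k + 1) = C (d k) * p k + r k)
    (hp : ∀ k < n, p (k + 1) = C (c k) * r (k + 1) * X + p k) {N : ℕ}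
    (hN : ∀ j, N < j → (p 0).coeff j = 0) (k : ℕ) (hk : k ≤ n) :
    (∀ j, N + k < j → (p k).coeff j = 0) ∧ (∀ j, N + k ≤ j → (r k).coeff j = 0) ∧
      (∃ U, IsUnit U ∧ (p k).coeff (N + k) = U * (p 0).coeff N) ∧
      (k < n → ∃ U, IsUnit U ∧ (r (k + 1)).coeff (N + k) = U * (p 0).coeff N) := by
  have lead : ∀ k, (∀ j, N + k ≤ j → (r k).coeff j = 0) →
      (∃ U, IsUnit U ∧ (p k).coeff (N + k) = U * (p 0).coeff N) →
      (k < n → ∃ U, IsUnit U ∧ (r (k + 1)).coeff (N + k) = U * (p 0).coeff N) := by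
    rintro k h2 ⟨U, hU, hUe⟩ hk
    refine ⟨d k * U, (hd k hk).mul hU, ?_⟩
    rw [hr k hk, coeff_add, coeff_C_mul, h2 _ le_rfl, add_zero, hUe, mul_assoc]
  induction k with
  | zero =>
    have h2 : ∀ j, N + 0 ≤ j → (r 0).coeff j = 0 := by simp [hr0]
    have h3 : ∃ U, IsUnit U ∧ (p 0).coeff (N + 0) = U * (p 0).coeff N := ⟨1, isUnit_one, by simp⟩
    exact ⟨hN, h2, h3, lead 0 h2 h3⟩
  | succ k ih =>
    have hk' : k < n := hk
    obtain ⟨h1, h2, -, h4⟩ := ih hk'.le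
    obtain ⟨V, hV, hVe⟩ := h4 hk'
    have h2' : ∀ j, N + (k + 1) ≤ j → (r (k + 1)).coeff j = 0 := by
      intro j hj
      rw [hr k hk', coeff_add, coeff_C_mul, h1 j (by omega), h2 j (by omega)]
      simp
    have h3' : ∃ U, IsUnit U ∧ (p (k + 1)).coeff (N + (k + 1)) = U * (p 0).coeff N := by
      refine ⟨c k * V, (hc k hk').mul hV, ?_⟩
      rw [hp k hk', coeff_add, ← add_assoc, coeff_mul_X, coeff_C_mul, hVe, h1 _ (by omega),
        add_zero, mul_assoc]
    refine ⟨fun j hj => ?_, h2', h3', lead _ h2' h3'⟩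
    obtain ⟨i, rfl⟩ : ∃ i, j = i + 1 := ⟨j - 1, by omega⟩
    rw [hp k hk', coeff_add, coeff_mul_X, coeff_C_mul, h2' i (by omega), h1 _ (by omega)]
    simp

/-- Telescoping for the Bezoutian of `(λ r^♯, p, p^♯, λ r)`. -/
lemma bezout_telescope_pos {q : ℕ} {c d : ℕ → Mat q} {n : ℕ} (hc : ∀ k < n, (c k).IsHermitian)
    (hd : ∀ k < n, (d k).IsHermitian) {p r : ℕ → (Mat q)[X]} (hr0 : r 0 = 0)
    (hr : ∀ k < n, r (k + 1) = C (d k) * p k + r k)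
    (hp : ∀ k < n, p (k + 1) = C (c k) * r (k + 1) * X + p k) (l u : ℂ) (k : ℕ) (hk : k ≤ n) :
    l • ((evalScalar ((starRingEnd ℂ) l) (r k))ᴴ * evalScalar u (p k))
      - u • ((evalScalar ((starRingEnd ℂ) l) (p k))ᴴ * evalScalar u (r k))
    = (l - u) • ∑ i ∈ Finset.range k,
        (evalScalar ((starRingEnd ℂ) l) (p i))ᴴ * d i * evalScalar u (p i) := by
  induction k with
  | zero => simp [hr0, evalScalar]
  | succ k ih =>
    have hk' : k < n := hk
    rw [Finset.sum_range_succ, smul_add, ← ih hk'.le, hp k hk']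
    simp only [evalScalar_add, evalScalar_mul_X, evalScalar_C_mul, conjTranspose_add,
      conjTranspose_mul, conjTranspose_smul, (hc k hk').eq, RCLike.star_def, Complex.conj_conj]
    rw [hr k hk']
    simp only [evalScalar_add, evalScalar_C_mul, conjTranspose_add,
      conjTranspose_mul, (hd k hk').eq, mul_add, add_mul, smul_add, smul_mul_assoc, mul_smul_comm,
      mul_assoc, sub_smul, smul_smul, mul_comm u l]
    abel

/-- Telescoping for the Bezoutian of `(r^♯, p, p^♯, r)`. -/
lemma bezout_telescope_neg {q : ℕ} {c d : ℕ → Mat q} {n : ℕ} (hc : ∀ k < n, (c k).IsHermitian)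
    (hd : ∀ k < n, (d k).IsHermitian) {p r : ℕ → (Mat q)[X]} (hr0 : r 0 = 0)
    (hr : ∀ k < n, r (k + 1) = C (d k) * p k + r k)
    (hp : ∀ k < n, p (k + 1) = C (c k) * r (k + 1) * X + p k) (l u : ℂ) (k : ℕ) (hk : k ≤ n) :
    (evalScalar ((starRingEnd ℂ) l) (r k))ᴴ * evalScalar u (p k)
      - (evalScalar ((starRingEnd ℂ) l) (p k))ᴴ * evalScalar u (r k)
    = -((l - u) • ∑ i ∈ Finset.range k,
        (evalScalar ((starRingEnd ℂ) l) (r (i + 1)))ᴴ * c i * evalScalar u (r (i + 1))) := by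
  induction k with
  | zero => simp [hr0, evalScalar]
  | succ k ih =>
    have hk' : k < n := hk
    rw [Finset.sum_range_succ, smul_add, neg_add, ← ih hk'.le, hp k hk']
    simp only [evalScalar_add, evalScalar_mul_X, evalScalar_C_mul, conjTranspose_add,
      conjTranspose_mul, conjTranspose_smul, (hc k hk').eq, RCLike.star_def, Complex.conj_conj]
    rw [hr k hk']
    simp only [evalScalar_add, evalScalar_C_mul, conjTranspose_add,
      conjTranspose_mul, (hd k hk').eq, mul_add, add_mul, smul_add, smul_mul_assoc, mul_smul_comm,
      mul_assoc, sub_smul]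
    abel

end Euclid

section Gram

open Polynomial

/-- The block row `(B_0, B_1, ..., B_{m-1})` of the first `m` coefficients of a matrix
polynomial. -/
def coeffRow {q : ℕ} (m : ℕ) (p : (Mat q)[X]) : Matrix (Fin q) (Fin m × Fin q) ℂ :=
  Matrix.of fun a x => p.coeff (x.1 : ℕ) a x.2

lemma coeffRow_mul_colPow {q m : ℕ} (p : (Mat q)[X]) (hp : ∀ j, m ≤ j → p.coeff j = 0) (z : ℂ) :
    coeffRow m p * colPow q m z = evalScalar z p := by
  rw [evalScalar_eq_sum z p hp, Finset.sum_range]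
  ext a b
  simp only [Matrix.mul_apply, coeffRow, colPow, Matrix.of_apply, Fintype.sum_prod_type,
    Matrix.sum_apply, Matrix.smul_apply, smul_eq_mul]
  refine Finset.sum_congr rfl fun j _ => ?_
  simp [mul_comm]

lemma blockForm_eq {q m : ℕ} (G : Matrix (Fin m × Fin q) (Fin m × Fin q) ℂ) (l u : ℂ) :
    (Matrix.of fun a b =>
      ∑ j : Fin m, ∑ k : Fin m, l ^ (j : ℕ) * u ^ (k : ℕ) * G (j, a) (k, b) : Mat q)
    = (colPow q m ((starRingEnd ℂ) l))ᴴ * G * colPow q m u := by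
  ext a b
  simp only [Matrix.mul_apply, colPow, Matrix.of_apply, Fintype.sum_prod_type,
    Matrix.conjTranspose_apply, Finset.sum_mul]
  rw [Finset.sum_comm]
  refine Finset.sum_congr rfl fun j _ => ?_
  simp [apply_ite, mul_comm, mul_left_comm]
  exact Finset.sum_congr rfl fun i _ => by ring

/-- The Gram-type block matrix of a family of matrix polynomials. -/
def gramSum {q : ℕ} (m : ℕ) (D : ℕ → Mat q) (p : ℕ → (Mat q)[X]) :
    Matrix (Fin m × Fin q) (Fin m × Fin q) ℂ :=
  ∑ i ∈ Finset.range m, (coeffRow m (p i))ᴴ * D i * coeffRow m (p i)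

lemma blockForm_gramSum {q m : ℕ} (D : ℕ → Mat q) (p : ℕ → (Mat q)[X])
    (hp : ∀ i < m, ∀ j, i < j → (p i).coeff j = 0) (l u : ℂ) :
    (Matrix.of fun a b => ∑ j : Fin m, ∑ k : Fin m,
      l ^ (j : ℕ) * u ^ (k : ℕ) * gramSum m D p (j, a) (k, b) : Mat q)
    = ∑ i ∈ Finset.range m,
        (evalScalar ((starRingEnd ℂ) l) (p i))ᴴ * D i * evalScalar u (p i) := by
  rw [blockForm_eq, gramSum, Matrix.mul_sum, Matrix.sum_mul]
  refine Finset.sum_congr rfl fun i hi => ?_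
  have him := Finset.mem_range.1 hi
  have h := coeffRow_mul_colPow (m := m) (p i) (fun j hj => hp i him j (him.trans_le hj))
  rw [← h, ← h, conjTranspose_mul]
  simp only [Matrix.mul_assoc]

lemma gramSum_posDef {q m : ℕ} {D : ℕ → Mat q} {p : ℕ → (Mat q)[X]}
    (hD : ∀ i < m, (D i).PosDef) (hp : ∀ i < m, ∀ j, i < j → (p i).coeff j = 0)
    (hu : ∀ i < m, IsUnit ((p i).coeff i)) : (gramSum m D p).PosDef := by
  have hpsd : ∀ i ∈ Finset.range m,
      ((coeffRow m (p i))ᴴ * D i * coeffRow m (p i)).PosSemidef := fun i hi =>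
    (hD i (Finset.mem_range.1 hi)).posSemidef.conjTranspose_mul_mul_same _
  have hS : (gramSum m D p).PosSemidef := by
    unfold gramSum
    exact Matrix.posSemidef_sum _ hpsd
  refine PosDef.of_dotProduct_mulVec_pos hS.isHermitian fun x hx => ?_
  refine lt_of_le_of_ne (hS.dotProduct_mulVec_nonneg x) fun h0 => hx ?_
  have hsum : ∑ i ∈ Finset.range m,
      star x ⬝ᵥ (((coeffRow m (p i))ᴴ * D i * coeffRow m (p i)) *ᵥ x) = 0 := by
    rw [← dotProduct_sum, ← Matrix.sum_mulVec]
    exact h0.symm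
  have hterm := (Finset.sum_eq_zero_iff_of_nonneg
    fun i hi => (hpsd i hi).dotProduct_mulVec_nonneg x).1 hsum
  have hrow : ∀ i < m, coeffRow m (p i) *ᵥ x = 0 := by
    intro i hi
    by_contra hne
    have h1 := hterm i (Finset.mem_range.2 hi)
    have h2 := (hD i hi).dotProduct_mulVec_pos hne
    rw [star_mulVec, dotProduct_mulVec, vecMul_vecMul, ← dotProduct_mulVec, mulVec_mulVec] at h2
    rw [h1] at h2
    exact lt_irrefl _ h2
  have hx0 : ∀ i, ∀ hi : i < m, ∀ b, x (⟨i, hi⟩, b) = 0 := by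
    intro i
    induction i using Nat.strong_induction_on with
    | _ i ih =>
      intro hi
      have h1 : (p i).coeff i *ᵥ (fun b => x (⟨i, hi⟩, b)) = 0 := by
        rw [← hrow i hi]
        ext a
        simp only [Matrix.mulVec, dotProduct, coeffRow, Matrix.of_apply, Fintype.sum_prod_type]
        rw [Finset.sum_eq_single (⟨i, hi⟩ : Fin m)]
        · intro j _ hj
          rcases lt_trichotomy (j : ℕ) i with hlt | heq | hgt
          · exact Finset.sum_eq_zero fun b _ => by rw [ih j hlt j.2 b, mul_zero]
          · exact absurd (Fin.ext heq) hj
          · exact Finset.sum_eq_zero fun b _ => by rw [hp i hi j hgt]; simp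
        · simp
      have h2 := Matrix.mulVec_injective_iff_isUnit.2 (hu i hi)
        (h1.trans (Matrix.mulVec_zero _).symm)
      exact fun b => congrFun h2 b
  ext ⟨j, b⟩
  exact hx0 j j.2 b

lemma blockForm_injective {q m : ℕ} (G G' : Matrix (Fin m × Fin q) (Fin m × Fin q) ℂ)
    (h : ∀ l u : ℂ,
      (l - u) • (Matrix.of fun a b => ∑ j : Fin m, ∑ k : Fin m,
        l ^ (j : ℕ) * u ^ (k : ℕ) * G' (j, a) (k, b) : Mat q)
      = (l - u) • (Matrix.of fun a b => ∑ j : Fin m, ∑ k : Fin m,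
        l ^ (j : ℕ) * u ^ (k : ℕ) * G (j, a) (k, b))) : G' = G := by
  have key : ∀ (s : Set ℂ) (v : Fin m → ℂ), s.Infinite →
      (∀ z ∈ s, ∑ j : Fin m, z ^ (j : ℕ) * v j = 0) → ∀ j, v j = 0 := by
    intro s v hs hv j
    have := coeff_eq_zero_of_infinite_zeros m (fun i => if hi : i < m then v ⟨i, hi⟩ else 0) s hs
      (fun z hz => by
        rw [Finset.sum_range, ← hv z hz]
        exact Finset.sum_congr rfl fun i _ => by simp) j j.2
    simpa using this
  have hd : ∀ a b, ∀ l u : ℂ, l ≠ u → ∑ j : Fin m, l ^ (j : ℕ) *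
      ∑ k : Fin m, u ^ (k : ℕ) * (G' (j, a) (k, b) - G (j, a) (k, b)) = 0 := by
    intro a b l u hlu
    have h1 := congrArg (fun N : Mat q => N a b)
      (smul_right_injective (Mat q) (sub_ne_zero.2 hlu) (h l u))
    simp only [Matrix.of_apply] at h1
    rw [← sub_eq_zero, ← Finset.sum_sub_distrib] at h1
    rw [← h1]
    refine Finset.sum_congr rfl fun j _ => ?_
    rw [← Finset.sum_sub_distrib, Finset.mul_sum]
    exact Finset.sum_congr rfl fun k _ => by ring
  ext ⟨j, a⟩ ⟨k, b⟩
  rw [← sub_eq_zero]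
  refine key Set.univ (fun k => G' (j, a) (k, b) - G (j, a) (k, b)) Set.infinite_univ
    (fun u _ => ?_) k
  exact key {u}ᶜ (fun j => ∑ k : Fin m, u ^ (k : ℕ) * (G' (j, a) (k, b) - G (j, a) (k, b)))
    (Set.finite_singleton u).infinite_compl (fun l hl => hd a b l u hl) j

end Gram

section Parts

open Polynomial

/-- The h-part as a formal polynomial. -/
def hPolynomial (q m : ℕ) (A : ℕ → Mat q) : (Mat q)[X] :=
  ∑ j ∈ Finset.range (m + 1), monomial (m - j) (A (2 * j))

/-- The g-part as a formal polynomial. -/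
def gPolynomial (q m : ℕ) (A : ℕ → Mat q) : (Mat q)[X] :=
  ∑ j ∈ Finset.range m, monomial (m - 1 - j) (A (2 * j + 1))

lemma evalScalar_hPolynomial (q m : ℕ) (A : ℕ → Mat q) (z : ℂ) :
    evalScalar z (hPolynomial q m A) = hEven q m A z := by
  simp only [hPolynomial, evalScalar_finsetSum, evalScalar_monomial, hEven]

lemma evalScalar_gPolynomial (q m : ℕ) (A : ℕ → Mat q) (z : ℂ) :
    evalScalar z (gPolynomial q m A) = gEven q m A z := by
  simp only [gPolynomial, evalScalar_finsetSum, evalScalar_monomial, gEven]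

lemma hPolynomial_coeff_top (q m : ℕ) (A : ℕ → Mat q) : (hPolynomial q m A).coeff m = A 0 := by
  simp only [hPolynomial, finsetSum_coeff, coeff_monomial]
  rw [Finset.sum_eq_single 0]
  · simp
  · intro j hj hj0
    have := Finset.mem_range.1 hj
    rw [if_neg (by omega)]
  · simp

lemma hPolynomial_coeff_of_lt (q m : ℕ) (A : ℕ → Mat q) (i : ℕ) (hi : m < i) :
    (hPolynomial q m A).coeff i = 0 := by
  simp only [hPolynomial, finsetSum_coeff, coeff_monomial]
  exact Finset.sum_eq_zero fun j _ => if_neg (by omega)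

/-- The h-part is invertible at all large real points. -/
lemma exists_det_hEven_ne_zero (q m : ℕ) (A : ℕ → Mat q) (hA0 : (A 0).det ≠ 0) :
    ∃ M : ℝ, 0 ≤ M ∧ ∀ x : ℝ, M < x → (hEven q m A x).det ≠ 0 := by
  let F : ℝ → ℂ := fun t => (∑ j ∈ Finset.range (m + 1), (t : ℂ) ^ j • A (2 * j)).det
  have hF : Continuous F := by
    refine Continuous.matrix_det (continuous_finsetSum _ fun j _ => ?_)
    fun_prop
  have hF0 : F 0 ≠ 0 := by
    have : F 0 = (A 0).det := by
      simp only [F]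
      rw [Finset.sum_range_succ']
      simp
    rwa [this]
  obtain ⟨ε, hε, hball⟩ := Metric.eventually_nhds_iff.1 (hF.continuousAt.eventually_ne hF0)
  refine ⟨ε⁻¹, (inv_pos.2 hε).le, fun x hx => ?_⟩
  have hx0 : 0 < x := (inv_pos.2 hε).trans hx
  have hxc : (x : ℂ) ≠ 0 := Complex.ofReal_ne_zero.2 hx0.ne'
  have h1 : F x⁻¹ ≠ 0 := hball (by
    rw [Real.dist_eq, sub_zero, abs_of_pos (inv_pos.2 hx0)]
    exact inv_lt_of_inv_lt₀ hε hx)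
  have h2 : hEven q m A x
      = (x : ℂ) ^ m • ∑ j ∈ Finset.range (m + 1), ((x⁻¹ : ℝ) : ℂ) ^ j • A (2 * j) := by
    rw [hEven, Finset.smul_sum]
    refine Finset.sum_congr rfl fun j hj => ?_
    have hj' : j ≤ m := Nat.lt_succ_iff.1 (Finset.mem_range.1 hj)
    rw [smul_smul, Complex.ofReal_inv, inv_pow, pow_sub₀ _ hxc hj']
  rw [h2, Matrix.det_smul]
  exact mul_ne_zero (pow_ne_zero _ (pow_ne_zero _ hxc)) h1

/-- The Euclidean chain of an HTM polynomial, with its degrees and leading coefficients. -/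
lemma IsHTMEven.exists_chain {q m : ℕ} (hm : 1 ≤ m) {A : ℕ → Mat q} (hA0 : (A 0).det ≠ 0)
    (hHTM : IsHTMEven q m (hEven q m A) (gEven q m A)) :
    ∃ (c d : ℕ → Mat q) (p r : ℕ → (Mat q)[X]),
      (∀ k < m, (c k).PosDef) ∧ (∀ k < m, (d k).PosDef) ∧
      p m = hPolynomial q m A ∧ r m = gPolynomial q m A ∧ r 0 = 0 ∧
      (∀ k < m, r (k + 1) = C (d k) * p k + r k) ∧
      (∀ k < m, p (k + 1) = C (c k) * r (k + 1) * X + p k) ∧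
      (∀ k < m, ∀ j, k < j → (p k).coeff j = 0) ∧ (∀ k < m, IsUnit ((p k).coeff k)) ∧
      (∀ k < m, ∀ j, k < j → (r (k + 1)).coeff j = 0) ∧
      (∀ k < m, IsUnit ((r (k + 1)).coeff k)) := by
  obtain ⟨c, d, hc, hd, hfrac⟩ := hHTM
  obtain ⟨M, hM, hdet⟩ := exists_det_hEven_ne_zero q m A hA0
  set c' : ℕ → Mat q := fun n => c (m - 1 - n) with hc'
  set d' : ℕ → Mat q := fun n => d (m - 1 - n) with hd'
  have hcp : ∀ k < m, (c' k).PosDef := fun k _ => hc _ (by omega)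
  have hdp : ∀ k < m, (d' k).PosDef := fun k _ => hd _ (by omega)
  obtain ⟨p, r, hpm, hrm, hr0, hrk, hpk⟩ := exists_euclid_seq m hcp hdp hM
    (hPolynomial q m A) (gPolynomial q m A) (fun x hx => by
      have hx0 : 0 < x := hM.trans_lt hx
      have hV : ∀ k ≤ m, (contFrac c' d' k x).PosSemidef := fun k hk =>
        contFrac_posSemidef (fun i hi => hcp i (hi.trans_le hk))
          (fun i hi => hdp i (hi.trans_le hk)) hx0
      have hdV : ∀ k < m, (d' k + contFrac c' d' k x).PosDef := fun k hk =>
        (hdp k hk).add_posSemidef (hV k hk.le)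
      have hw : ∀ j < m, IsUnit (wEven q m c d j x).det := by
        intro j hj
        rw [← Matrix.isUnit_nonsing_inv_det_iff, inv_wEven_eq_contFrac, contFrac,
          Matrix.isUnit_nonsing_inv_det_iff]
        exact (Matrix.isUnit_iff_isUnit_det _).1
          (((hcp j hj).smul (Complex.zero_lt_real.2 hx0)).add (hdV j hj).inv).isUnit
      have hfx := hfrac x (hdet x hx) hw (fun j hj => by
        rw [inv_wEven_eq_contFrac]
        have e : m - 2 - j = m - 1 - (j + 1) := by omega
        rw [e]
        exact (Matrix.isUnit_iff_isUnit_det _).1 (hdV (j + 1) hj).isUnit)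
      rw [inv_wEven_eq_contFrac, Nat.sub_add_cancel hm] at hfx
      rw [evalScalar_gPolynomial, evalScalar_hPolynomial, ← hfx,
        Matrix.nonsing_inv_mul_cancel_right _ _ (isUnit_iff_ne_zero.2 (hdet x hx))])
  have key := euclid_seq_coeff (fun k hk => (hcp k hk).isUnit) (fun k hk => (hdp k hk).isUnit)
    hr0 hrk hpk (N := (p 0).natDegree) (fun j hj => coeff_eq_zero_of_natDegree_lt hj)
  have hN : (p 0).natDegree = 0 := by
    by_contra hne
    obtain ⟨-, -, ⟨U, hU, hUe⟩, -⟩ := key m le_rfl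
    rw [hpm, hPolynomial_coeff_of_lt _ _ _ _ (by omega)] at hUe
    have h0 : (p 0).leadingCoeff = 0 := (hU.mul_right_eq_zero).1 hUe.symm
    rw [leadingCoeff_eq_zero] at h0
    exact hne (by simp [h0])
  simp only [hN, zero_add] at key
  have hκ : IsUnit ((p 0).coeff 0) := by
    obtain ⟨-, -, ⟨U, hU, hUe⟩, -⟩ := key m le_rfl
    rw [hpm, hPolynomial_coeff_top] at hUe
    rw [Matrix.isUnit_iff_isUnit_det]
    refine isUnit_iff_ne_zero.2 fun h0 => hA0 ?_
    rw [hUe, Matrix.det_mul, h0, mul_zero]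
  refine ⟨c', d', p, r, hcp, hdp, hpm, hrm, hr0, hrk, hpk, fun k hk => (key k hk.le).1,
    fun k hk => ?_, fun k hk => (key (k + 1) hk).2.1, fun k hk => ?_⟩
  · obtain ⟨-, -, ⟨U, hU, hUe⟩, -⟩ := key k hk.le
    exact hUe ▸ hU.mul hκ
  · obtain ⟨U, hU, hUe⟩ := (key k hk.le).2.2.2 hk
    exact hUe ▸ hU.mul hκ

end Parts

theorem stmt_17 (q m : ℕ) (hq : 1 ≤ q) (hm : 1 ≤ m) (A : ℕ → Mat q)
    (hA0 : (A 0).det ≠ 0)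
    (hHTM : IsHTMEven q m (hEven q m A) (gEven q m A)) :
    (∃ G : Matrix (Fin m × Fin q) (Fin m × Fin q) ℂ,
      (∀ l u : ℂ,
        l • ((gEven q m A ((starRingEnd ℂ) l))ᴴ * hEven q m A u)
          - u • ((hEven q m A ((starRingEnd ℂ) l))ᴴ * gEven q m A u)
        = (l - u) • (Matrix.of fun a b =>
            ∑ j : Fin m, ∑ k : Fin m, l ^ (j : ℕ) * u ^ (k : ℕ) * G (j, a) (k, b))) ∧
      G.PosDef ∧
      ∀ G' : Matrix (Fin m × Fin q) (Fin m × Fin q) ℂ,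
        (∀ l u : ℂ,
          l • ((gEven q m A ((starRingEnd ℂ) l))ᴴ * hEven q m A u)
            - u • ((hEven q m A ((starRingEnd ℂ) l))ᴴ * gEven q m A u)
          = (l - u) • (Matrix.of fun a b =>
              ∑ j : Fin m, ∑ k : Fin m, l ^ (j : ℕ) * u ^ (k : ℕ) * G' (j, a) (k, b))) →
        G' = G) ∧
    (∃ G : Matrix (Fin m × Fin q) (Fin m × Fin q) ℂ,
      (∀ l u : ℂ,
        (gEven q m A ((starRingEnd ℂ) l))ᴴ * hEven q m A u
          - (hEven q m A ((starRingEnd ℂ) l))ᴴ * gEven q m A u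
        = (l - u) • (Matrix.of fun a b =>
            ∑ j : Fin m, ∑ k : Fin m, l ^ (j : ℕ) * u ^ (k : ℕ) * G (j, a) (k, b))) ∧
      (-G).PosDef ∧
      ∀ G' : Matrix (Fin m × Fin q) (Fin m × Fin q) ℂ,
        (∀ l u : ℂ,
          (gEven q m A ((starRingEnd ℂ) l))ᴴ * hEven q m A u
            - (hEven q m A ((starRingEnd ℂ) l))ᴴ * gEven q m A u
          = (l - u) • (Matrix.of fun a b =>
              ∑ j : Fin m, ∑ k : Fin m, l ^ (j : ℕ) * u ^ (k : ℕ) * G' (j, a) (k, b))) →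
        G' = G) := by
  obtain ⟨c, d, p, r, hc, hd, hpm, hrm, hr0, hrk, hpk, hpz, hpu, hrz, hru⟩ :=
    hHTM.exists_chain hm hA0
  have hcH : ∀ k < m, (c k).IsHermitian := fun k hk => (hc k hk).isHermitian
  have hdH : ∀ k < m, (d k).IsHermitian := fun k hk => (hd k hk).isHermitian
  refine ⟨⟨gramSum m d p, ?_, gramSum_posDef hd hpz hpu, ?_⟩,
    ⟨-gramSum m c (fun i => r (i + 1)), ?_, ?_, ?_⟩⟩
  · intro l u
    rw [blockForm_gramSum d p hpz, ← bezout_telescope_pos hcH hdH hr0 hrk hpk l u m le_rfl, hpm,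
      hrm]
    simp only [evalScalar_hPolynomial, evalScalar_gPolynomial]
  · intro G' hG'
    refine blockForm_injective _ _ fun l u => ?_
    rw [← hG' l u, blockForm_gramSum d p hpz,
      ← bezout_telescope_pos hcH hdH hr0 hrk hpk l u m le_rfl, hpm, hrm]
    simp only [evalScalar_hPolynomial, evalScalar_gPolynomial]
  all_goals
    have hneg : ∀ l u : ℂ, (gEven q m A ((starRingEnd ℂ) l))ᴴ * hEven q m A u
          - (hEven q m A ((starRingEnd ℂ) l))ᴴ * gEven q m A u
        = (l - u) • (Matrix.of fun a b => ∑ j : Fin m, ∑ k : Fin m,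
            l ^ (j : ℕ) * u ^ (k : ℕ) * (-gramSum m c (fun i => r (i + 1))) (j, a) (k, b)) := by
      intro l u
      have h := bezout_telescope_neg hcH hdH hr0 hrk hpk l u m le_rfl
      rw [hpm, hrm, ← blockForm_gramSum c (fun i => r (i + 1)) hrz] at h
      simp only [evalScalar_hPolynomial, evalScalar_gPolynomial] at h
      rw [h, blockForm_eq, blockForm_eq, Matrix.mul_neg, Matrix.neg_mul, smul_neg]
  · exact hneg
  · rw [neg_neg]
    exact gramSum_posDef hc hrz hru
  · intro G' hG'
    exact blockForm_injective _ _ fun l u => by rw [← hG' l u, hneg l u]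

end
end
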